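/- In the space F(3) of degree-3 foliations of ℙ²(ℂ) with the PGL₃(ℂ)-action by pullback: (1) the orbits O(F₁) and O(F₂) of the foliations F₁ and F₂, given in the chart z = 1 by ω̄₁ = y³dx + x³(x dy − y dx) and ω̄₂ = x³dx + y³(x dy − y dx), are closed in F(3); (2) the closure in F(3) of the orbit of the Fermat foliation F₃, given by ω̄₃ = (x³−x)dy − (y³−y)dx, equals O(F₁) ∪ O(H₁) ∪ O(H₃) ∪ O(F₃), where H₁ and H₃ are the homogeneous foliations given by ω₁ = y³dx − x³dy and ω₃ = y²(3x+y)dx − x²(x+3y)dy. -/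

import Mathlib

open MvPolynomial

noncomputable section

/-- Substitution of the linear change of variables on `ℂ³` given by the matrix `M`. -/
def subst3 (M : Matrix (Fin 3) (Fin 3) ℂ) (P : MvPolynomial (Fin 3) ℂ) :
    MvPolynomial (Fin 3) ℂ :=
  aeval (fun i => ∑ j, C (M i j) * X j) P

/-- Pullback of the 1-form with coefficient vector `Ω` by the linear map of matrix `M`. -/
def pb3 (M : Matrix (Fin 3) (Fin 3) ℂ) (Ω : Fin 3 → MvPolynomial (Fin 3) ℂ) :
    Fin 3 → MvPolynomial (Fin 3) ℂ :=
  fun i => ∑ j, C (M j i) * subst3 M (Ω j)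

/-- Two foliations (given by their projective 1-forms) are linearly conjugate:
`T*Ω = c·Ω'` for some `T ∈ GL₃(ℂ)` and `c ∈ ℂ*`. -/
def LinConj3 (Ω Ω' : Fin 3 → MvPolynomial (Fin 3) ℂ) : Prop :=
  ∃ (M : Matrix (Fin 3) (Fin 3) ℂ) (c : ℂ), IsUnit M.det ∧ c ≠ 0 ∧
    pb3 M Ω = fun i => C c * Ω' i

/-- The orbit of the 1-form `Ω` under pullback by `GL₃(ℂ)` and nonzero rescaling
(the cone over the `PGL₃(ℂ)`-orbit of the corresponding foliation). -/
def OrbitOf (Ω : Fin 3 → MvPolynomial (Fin 3) ℂ) :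
    Set (Fin 3 → MvPolynomial (Fin 3) ℂ) :=
  {Ω' | LinConj3 Ω Ω'}

/-- `Ω` defines a degree-`d` foliation of `ℙ²(ℂ)`: it is a nonzero 1-form with
homogeneous coefficients of degree `d + 1` annihilating the radial vector field and
with no common factor. -/
def IsFolDeg (d : ℕ) (Ω : Fin 3 → MvPolynomial (Fin 3) ℂ) : Prop :=
  Ω ≠ 0 ∧ (∀ i, (Ω i).IsHomogeneous (d + 1)) ∧
    X 0 * Ω 0 + X 1 * Ω 1 + X 2 * Ω 2 = 0 ∧
    ∀ h : MvPolynomial (Fin 3) ℂ, (∀ i, h ∣ Ω i) → IsUnit h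

/-- The coefficient vector of a triple of polynomials. -/
def coeffs (Ω : Fin 3 → MvPolynomial (Fin 3) ℂ) : Fin 3 → (Fin 3 →₀ ℕ) → ℂ :=
  fun i m => coeff m (Ω i)

/-- Closure, inside the space `F(d)` of degree-`d` foliations with its classical
topology (read off on the coefficients), of a set of defining 1-forms. -/
def FClos (d : ℕ) (S : Set (Fin 3 → MvPolynomial (Fin 3) ℂ)) :
    Set (Fin 3 → MvPolynomial (Fin 3) ℂ) :=
  {Ω' | IsFolDeg d Ω' ∧ coeffs Ω' ∈ closure (coeffs '' S)}

/-- `√3` as a complex number. -/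
def s3 : ℂ := (Real.sqrt 3 : ℝ)

/-- Projective 1-form of `H₁ : y³dx − x³dy`. -/
def OmH1 : Fin 3 → MvPolynomial (Fin 3) ℂ :=
  ![X 2 * X 1 ^ 3, -(X 2 * X 0 ^ 3), X 0 ^ 3 * X 1 - X 0 * X 1 ^ 3]

/-- Projective 1-form of `H₂ : x³dx − y³dy`. -/
def OmH2 : Fin 3 → MvPolynomial (Fin 3) ℂ :=
  ![X 2 * X 0 ^ 3, -(X 2 * X 1 ^ 3), X 1 ^ 4 - X 0 ^ 4]

/-- Projective 1-form of `H₃ : y²(3x+y)dx − x²(x+3y)dy`. -/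
def OmH3 : Fin 3 → MvPolynomial (Fin 3) ℂ :=
  ![X 2 * (3 * X 0 * X 1 ^ 2 + X 1 ^ 3), -(X 2 * (X 0 ^ 3 + 3 * X 0 ^ 2 * X 1)),
    X 0 ^ 3 * X 1 - X 0 * X 1 ^ 3]

/-- Projective 1-form of `H₄ : y²(3x+y)dx + x²(x+3y)dy`. -/
def OmH4 : Fin 3 → MvPolynomial (Fin 3) ℂ :=
  ![X 2 * (3 * X 0 * X 1 ^ 2 + X 1 ^ 3), X 2 * (X 0 ^ 3 + 3 * X 0 ^ 2 * X 1),
    -(X 0 ^ 3 * X 1 + 6 * X 0 ^ 2 * X 1 ^ 2 + X 0 * X 1 ^ 3)]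

/-- Projective 1-form of `H₅ : 2y³dx + x²(3y−2x)dy`. -/
def OmH5 : Fin 3 → MvPolynomial (Fin 3) ℂ :=
  ![2 * X 2 * X 1 ^ 3, X 2 * (3 * X 0 ^ 2 * X 1 - 2 * X 0 ^ 3),
    -(2 * X 0 * X 1 ^ 3 + 3 * X 0 ^ 2 * X 1 ^ 2 - 2 * X 0 ^ 3 * X 1)]

/-- Projective 1-form of `H₆ : (4x³−6x²y+4y³)dx + x²(3y−2x)dy`. -/
def OmH6 : Fin 3 → MvPolynomial (Fin 3) ℂ :=
  ![X 2 * (4 * X 0 ^ 3 - 6 * X 0 ^ 2 * X 1 + 4 * X 1 ^ 3),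
    X 2 * (3 * X 0 ^ 2 * X 1 - 2 * X 0 ^ 3),
    -(4 * X 0 ^ 4 - 8 * X 0 ^ 3 * X 1 + 3 * X 0 ^ 2 * X 1 ^ 2 + 4 * X 0 * X 1 ^ 3)]

/-- Projective 1-form of `H₇ : y³dx + x(3y²−x²)dy`. -/
def OmH7 : Fin 3 → MvPolynomial (Fin 3) ℂ :=
  ![X 2 * X 1 ^ 3, X 2 * (3 * X 0 * X 1 ^ 2 - X 0 ^ 3),
    X 0 ^ 3 * X 1 - 4 * X 0 * X 1 ^ 3]

/-- Projective 1-form of `H₈ : x(x²−3y²)dx − 4y³dy`. -/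
def OmH8 : Fin 3 → MvPolynomial (Fin 3) ℂ :=
  ![X 2 * (X 0 ^ 3 - 3 * X 0 * X 1 ^ 2), -(4 * X 2 * X 1 ^ 3),
    -(X 0 ^ 4 - 3 * X 0 ^ 2 * X 1 ^ 2 - 4 * X 1 ^ 4)]

/-- Projective 1-form of `H₉ : y²((−3+i√3)x+2y)dx + x²((1+i√3)x−2i√3·y)dy`. -/
def OmH9 : Fin 3 → MvPolynomial (Fin 3) ℂ :=
  ![X 2 * (C (-3 + Complex.I * s3) * X 0 * X 1 ^ 2 + 2 * X 1 ^ 3),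
    X 2 * (C (1 + Complex.I * s3) * X 0 ^ 3 - C (2 * (Complex.I * s3)) * X 0 ^ 2 * X 1),
    -(C (1 + Complex.I * s3) * X 0 ^ 3 * X 1 + C (-3 - Complex.I * s3) * X 0 ^ 2 * X 1 ^ 2 +
      2 * X 0 * X 1 ^ 3)]

/-- Projective 1-form of
`H₁₁ : (3x³+3√3x²y+3xy²+√3y³)dx + (√3x³+3x²y+3√3xy²+3y³)dy`. -/
def OmH11 : Fin 3 → MvPolynomial (Fin 3) ℂ :=
  ![X 2 * (3 * X 0 ^ 3 + C (3 * s3) * X 0 ^ 2 * X 1 + 3 * X 0 * X 1 ^ 2 + C s3 * X 1 ^ 3),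
    X 2 * (C s3 * X 0 ^ 3 + 3 * X 0 ^ 2 * X 1 + C (3 * s3) * X 0 * X 1 ^ 2 + 3 * X 1 ^ 3),
    -(3 * X 0 ^ 4 + C (4 * s3) * X 0 ^ 3 * X 1 + 6 * X 0 ^ 2 * X 1 ^ 2 +
      C (4 * s3) * X 0 * X 1 ^ 3 + 3 * X 1 ^ 4)]

/-- Projective 1-form of `F₁ : y³dx + x³(x dy − y dx)`. -/
def OmF1 : Fin 3 → MvPolynomial (Fin 3) ℂ :=
  ![X 2 * X 1 ^ 3 - X 0 ^ 3 * X 1, X 0 ^ 4, -(X 0 * X 1 ^ 3)]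

/-- Projective 1-form of `F₂ : x³dx + y³(x dy − y dx)`. -/
def OmF2 : Fin 3 → MvPolynomial (Fin 3) ℂ :=
  ![X 2 * X 0 ^ 3 - X 1 ^ 4, X 0 * X 1 ^ 3, -(X 0 ^ 4)]

/-- Projective 1-form of the Fermat foliation `F₃ : (x³−x)dy − (y³−y)dx`. -/
def OmF3 : Fin 3 → MvPolynomial (Fin 3) ℂ :=
  ![X 1 * X 2 ^ 3 - X 1 ^ 3 * X 2, X 0 ^ 3 * X 2 - X 0 * X 2 ^ 3,
    X 0 * X 1 ^ 3 - X 0 ^ 3 * X 1]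

/-- Projective 1-form of `F₄ : (x³+y³)dx + x³(x dy − y dx)`. -/
def OmF4 : Fin 3 → MvPolynomial (Fin 3) ℂ :=
  ![X 2 * (X 0 ^ 3 + X 1 ^ 3) - X 0 ^ 3 * X 1, X 0 ^ 4, -(X 0 ^ 4 + X 0 * X 1 ^ 3)]

/-- Projective 1-form of `F₅ : y²(y dx + 2x dy) + x³(x dy − y dx)`. -/
def OmF5 : Fin 3 → MvPolynomial (Fin 3) ℂ :=
  ![X 2 * X 1 ^ 3 - X 0 ^ 3 * X 1, 2 * X 0 * X 1 ^ 2 * X 2 + X 0 ^ 4,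
    -(3 * X 0 * X 1 ^ 3)]


section

lemma eval_subst3 (M : Matrix (Fin 3) (Fin 3) ℂ) (P : MvPolynomial (Fin 3) ℂ) (v : Fin 3 → ℂ) :
    eval v (subst3 M P) = eval (M.mulVec v) P := by
  unfold subst3
  induction P using MvPolynomial.induction_on with
  | C a => simp
  | add p q hp hq => simp only [map_add, hp, hq]
  | mul_X p i hp =>
    simp only [map_mul, hp, aeval_X, map_sum, eval_C, eval_X]
    rfl

lemma eval_pb3 (M : Matrix (Fin 3) (Fin 3) ℂ) (Ω : Fin 3 → MvPolynomial (Fin 3) ℂ)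
    (v : Fin 3 → ℂ) (i : Fin 3) :
    eval v (pb3 M Ω i) = ∑ j, M j i * eval (M.mulVec v) (Ω j) := by
  simp [pb3, eval_subst3]

lemma pb3_mul (M N : Matrix (Fin 3) (Fin 3) ℂ) (Ω : Fin 3 → MvPolynomial (Fin 3) ℂ) :
    pb3 (M * N) Ω = pb3 N (pb3 M Ω) := by
  funext i
  apply MvPolynomial.funext
  intro v
  simp only [eval_pb3, Matrix.mul_apply, Matrix.mulVec_mulVec, Finset.mul_sum, Finset.sum_mul]
  rw [Finset.sum_comm]
  refine Finset.sum_congr rfl fun j _ => Finset.sum_congr rfl fun k _ => ?_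
  ring

lemma pb3_one (Ω : Fin 3 → MvPolynomial (Fin 3) ℂ) : pb3 1 Ω = Ω := by
  funext i
  apply MvPolynomial.funext
  intro v
  simp [eval_pb3, Matrix.one_apply]

lemma pb3_smul (M : Matrix (Fin 3) (Fin 3) ℂ) (c : ℂ) (Ω : Fin 3 → MvPolynomial (Fin 3) ℂ) :
    pb3 M (fun i => C c * Ω i) = fun i => C c * pb3 M Ω i := by
  funext i
  apply MvPolynomial.funext
  intro v
  simp only [eval_pb3, map_mul, eval_C, Finset.mul_sum]
  refine Finset.sum_congr rfl fun j _ => ?_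
  ring

lemma LinConj3.refl (Ω : Fin 3 → MvPolynomial (Fin 3) ℂ) : LinConj3 Ω Ω :=
  ⟨1, 1, by simp, one_ne_zero, by simp [pb3_one]⟩

lemma LinConj3.trans {A B D : Fin 3 → MvPolynomial (Fin 3) ℂ} (h1 : LinConj3 A B)
    (h2 : LinConj3 B D) : LinConj3 A D := by
  obtain ⟨M, c, hM, hc, h⟩ := h1
  obtain ⟨N, d, hN, hd, h'⟩ := h2
  refine ⟨M * N, c * d, by rw [Matrix.det_mul]; exact hM.mul hN, mul_ne_zero hc hd, ?_⟩
  rw [pb3_mul, h, pb3_smul, h']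
  funext i
  simp [mul_assoc]

lemma LinConj3.symm {A B : Fin 3 → MvPolynomial (Fin 3) ℂ} (h1 : LinConj3 A B) :
    LinConj3 B A := by
  obtain ⟨M, c, hM, hc, h⟩ := h1
  refine ⟨M⁻¹, c⁻¹, by simpa using hM, inv_ne_zero hc, ?_⟩
  have h2 : B = fun i => C c⁻¹ * pb3 M A i := by
    rw [h]; funext i; simp [← mul_assoc, ← C_mul, hc]
  rw [h2, pb3_smul, ← pb3_mul, Matrix.mul_nonsing_inv _ hM, pb3_one]

lemma linConj3_of_eval {A B : Fin 3 → MvPolynomial (Fin 3) ℂ} (M : Matrix (Fin 3) (Fin 3) ℂ)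
    (c : ℂ) (hM : M.det ≠ 0) (hc : c ≠ 0)
    (h : ∀ x y z : ℂ, ∀ i, M 0 i * eval (M.mulVec ![x, y, z]) (A 0)
      + M 1 i * eval (M.mulVec ![x, y, z]) (A 1) + M 2 i * eval (M.mulVec ![x, y, z]) (A 2)
      = c * eval ![x, y, z] (B i)) : LinConj3 A B := by
  refine ⟨M, c, isUnit_iff_ne_zero.2 hM, hc, ?_⟩
  funext i
  apply MvPolynomial.funext
  intro v
  have hv : v = ![v 0, v 1, v 2] := by
    funext j; fin_cases j <;> rfl
  rw [eval_pb3, Fin.sum_univ_three, hv, h, map_mul, eval_C]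

lemma subst3_mul (M N : Matrix (Fin 3) (Fin 3) ℂ) (P : MvPolynomial (Fin 3) ℂ) :
    subst3 N (subst3 M P) = subst3 (M * N) P := by
  apply MvPolynomial.funext
  intro v
  simp [eval_subst3, Matrix.mulVec_mulVec]

lemma subst3_one (P : MvPolynomial (Fin 3) ℂ) : subst3 1 P = P := by
  apply MvPolynomial.funext
  intro v
  simp [eval_subst3]

lemma subst3_hom {n : ℕ} (M : Matrix (Fin 3) (Fin 3) ℂ) {P : MvPolynomial (Fin 3) ℂ}
    (h : P.IsHomogeneous n) : (subst3 M P).IsHomogeneous n := by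
  have := h.aeval (fun i => ∑ j, C (M i j) * X j : Fin 3 → MvPolynomial (Fin 3) ℂ) (n := 1)
    (fun i => IsHomogeneous.sum _ _ _ fun j _ => by
      simpa using (isHomogeneous_C (Fin 3) (M i j)).mul (isHomogeneous_X ℂ j))
  simpa [subst3] using this

lemma pb3_hom {n : ℕ} (M : Matrix (Fin 3) (Fin 3) ℂ) {Ω : Fin 3 → MvPolynomial (Fin 3) ℂ}
    (h : ∀ i, (Ω i).IsHomogeneous n) (i : Fin 3) : (pb3 M Ω i).IsHomogeneous n := by
  refine IsHomogeneous.sum _ _ _ fun j _ => ?_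
  simpa using (isHomogeneous_C (Fin 3) (M j i)).mul (subst3_hom M (h j))

lemma dvd_pb3 {h : MvPolynomial (Fin 3) ℂ} {Ω : Fin 3 → MvPolynomial (Fin 3) ℂ}
    (M : Matrix (Fin 3) (Fin 3) ℂ) (hd : ∀ i, h ∣ Ω i) (i : Fin 3) :
    subst3 M h ∣ pb3 M Ω i := by
  refine Finset.dvd_sum fun j _ => Dvd.dvd.mul_left ?_ _
  exact map_dvd (aeval (fun i => ∑ j, C (M i j) * X j : Fin 3 → MvPolynomial (Fin 3) ℂ)) (hd j)

lemma isFol_of_conj {A B : Fin 3 → MvPolynomial (Fin 3) ℂ} (hAB : LinConj3 A B)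
    (hA : IsFolDeg 3 A) : IsFolDeg 3 B := by
  obtain ⟨M, c, hM, hc, h⟩ := hAB
  have hB : B = fun i => C c⁻¹ * pb3 M A i := by
    rw [h]; funext i; simp [← mul_assoc, ← C_mul, hc]
  have hA2 : A = fun i => C c * pb3 M⁻¹ B i := by
    rw [← pb3_smul, ← h, ← pb3_mul, Matrix.mul_nonsing_inv _ hM, pb3_one]
  obtain ⟨h0, hh, hr, hs⟩ := hA
  refine ⟨?_, ?_, ?_, ?_⟩
  · rintro rfl
    apply h0
    rw [hA2]
    funext i
    simp [pb3, subst3]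
  · intro i
    rw [hB]
    simpa using (isHomogeneous_C (Fin 3) c⁻¹).mul (pb3_hom M hh i)
  · apply MvPolynomial.funext
    intro v
    have := congrArg (eval (M.mulVec v)) hr
    simp only [map_add, map_mul, eval_X, map_zero, Matrix.mulVec, dotProduct,
      Fin.sum_univ_three] at this
    simp only [hB, map_add, map_mul, eval_X, map_zero, eval_C, eval_pb3, Fin.sum_univ_three,
      Matrix.mulVec, dotProduct]
    linear_combination c⁻¹ * this
  · intro g hg
    have h1 : ∀ i, subst3 M⁻¹ g ∣ A i := by
      intro i
      rw [hA2]
      exact (dvd_pb3 M⁻¹ hg i).mul_left _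
    have h2 := hs _ h1
    have h3 : IsUnit (subst3 M (subst3 M⁻¹ g)) :=
      h2.map (aeval (fun i => ∑ j, C (M i j) * X j : Fin 3 → MvPolynomial (Fin 3) ℂ))
    rwa [subst3_mul, Matrix.nonsing_inv_mul _ hM, subst3_one] at h3

end

section

open Filter Topology

lemma tendsto_coeff_mul {ι : Type*} {G : Filter ι} {f g : ι → MvPolynomial (Fin 3) ℂ}
    {p q : MvPolynomial (Fin 3) ℂ}
    (hf : ∀ m, Tendsto (fun t => coeff m (f t)) G (𝓝 (coeff m p)))
    (hg : ∀ m, Tendsto (fun t => coeff m (g t)) G (𝓝 (coeff m q))) (m : Fin 3 →₀ ℕ) :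
    Tendsto (fun t => coeff m (f t * g t)) G (𝓝 (coeff m (p * q))) := by
  simp only [coeff_mul]
  exact tendsto_finsetSum _ fun x _ => (hf _).mul (hg _)

lemma tendsto_coeff_C {ι : Type*} {G : Filter ι} {f : ι → ℂ} {a : ℂ}
    (hf : Tendsto f G (𝓝 a)) (m : Fin 3 →₀ ℕ) :
    Tendsto (fun t => coeff m (C (f t) : MvPolynomial (Fin 3) ℂ)) G
      (𝓝 (coeff m (C a : MvPolynomial (Fin 3) ℂ))) := by
  simp only [coeff_C]
  split_ifs
  · exact hf
  · exact tendsto_const_nhds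

lemma tendsto_coeff_sum {ι : Type*} {G : Filter ι} {κ : Type*} (s : Finset κ)
    {f : κ → ι → MvPolynomial (Fin 3) ℂ} {p : κ → MvPolynomial (Fin 3) ℂ}
    (hf : ∀ k m, Tendsto (fun t => coeff m (f k t)) G (𝓝 (coeff m (p k)))) (m : Fin 3 →₀ ℕ) :
    Tendsto (fun t => coeff m (∑ k ∈ s, f k t)) G (𝓝 (coeff m (∑ k ∈ s, p k))) := by
  simp only [coeff_sum]
  exact tendsto_finsetSum _ fun k _ => hf k m

lemma tendsto_coeff_subst_fix {ι : Type*} {G : Filter ι}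
    {U : ι → Matrix (Fin 3) (Fin 3) ℂ} {V : Matrix (Fin 3) (Fin 3) ℂ}
    (hU : ∀ i j, Tendsto (fun t => U t i j) G (𝓝 (V i j))) (P : MvPolynomial (Fin 3) ℂ) :
    ∀ m, Tendsto (fun t => coeff m (subst3 (U t) P)) G (𝓝 (coeff m (subst3 V P))) := by
  unfold subst3
  induction P using MvPolynomial.induction_on with
  | C a => intro m; simp only [algHom_C]; exact tendsto_const_nhds
  | add p q hp hq =>
    intro m
    simp only [map_add, coeff_add]
    exact (hp m).add (hq m)
  | mul_X p i hp =>
    intro m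
    simp only [map_mul, aeval_X]
    refine tendsto_coeff_mul hp (tendsto_coeff_sum _ fun k => ?_) m
    exact tendsto_coeff_mul (tendsto_coeff_C (hU i k)) fun m => tendsto_const_nhds

/-- the exponents of degree 4 -/
def S4 : Finset (Fin 3 →₀ ℕ) := Finset.finsuppAntidiag Finset.univ 4

lemma hom_eq_sum {P : MvPolynomial (Fin 3) ℂ} (h : P.IsHomogeneous 4) :
    P = ∑ m ∈ S4, C (coeff m P) * monomial m 1 := by
  ext n
  simp only [coeff_sum, coeff_C_mul, coeff_monomial]
  simp only [mul_ite, mul_one, mul_zero, Finset.sum_ite_eq']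
  split_ifs with hn
  · rfl
  · by_contra hne
    apply hn
    have := h hne
    rw [S4, Finset.mem_finsuppAntidiag]
    refine ⟨?_, Finset.subset_univ _⟩
    rw [← this, Finsupp.weight_apply, Finsupp.sum_fintype _ _ (by simp)]
    simp

lemma tendsto_coeff_subst {ι : Type*} {G : Filter ι}
    {U : ι → Matrix (Fin 3) (Fin 3) ℂ} {V : Matrix (Fin 3) (Fin 3) ℂ}
    (hU : ∀ i j, Tendsto (fun t => U t i j) G (𝓝 (V i j)))
    {P : ι → MvPolynomial (Fin 3) ℂ} {Q : MvPolynomial (Fin 3) ℂ}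
    (hP : ∀ t, (P t).IsHomogeneous 4) (hQ : Q.IsHomogeneous 4)
    (hPQ : ∀ m, Tendsto (fun t => coeff m (P t)) G (𝓝 (coeff m Q))) :
    ∀ m, Tendsto (fun t => coeff m (subst3 (U t) (P t))) G (𝓝 (coeff m (subst3 V Q))) := by
  have key : ∀ (M : Matrix (Fin 3) (Fin 3) ℂ) (P : MvPolynomial (Fin 3) ℂ), P.IsHomogeneous 4 →
      subst3 M P = ∑ m ∈ S4, C (coeff m P) * subst3 M (monomial m 1) := by
    intro M P h
    conv_lhs => rw [hom_eq_sum h]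
    simp only [subst3, map_sum, map_mul, algHom_C]
    rfl
  intro m
  rw [key V Q hQ]
  simp only [key _ _ (hP _)]
  refine tendsto_coeff_sum _ (fun k => ?_) m
  exact tendsto_coeff_mul (tendsto_coeff_C (hPQ k)) (tendsto_coeff_subst_fix hU _)

lemma tendsto_coeffs_pb {ι : Type*} {G : Filter ι}
    {U : ι → Matrix (Fin 3) (Fin 3) ℂ} {V : Matrix (Fin 3) (Fin 3) ℂ}
    (hU : ∀ i j, Tendsto (fun t => U t i j) G (𝓝 (V i j)))
    {A : ι → Fin 3 → MvPolynomial (Fin 3) ℂ} {B : Fin 3 → MvPolynomial (Fin 3) ℂ}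
    (hA : ∀ t i, (A t i).IsHomogeneous 4) (hB : ∀ i, (B i).IsHomogeneous 4)
    (hAB : ∀ i m, Tendsto (fun t => coeff m (A t i)) G (𝓝 (coeff m (B i)))) :
    ∀ i m, Tendsto (fun t => coeff m (pb3 (U t) (A t) i)) G (𝓝 (coeff m (pb3 V B i))) := by
  intro i m
  refine tendsto_coeff_sum _ (fun k => ?_) m
  exact tendsto_coeff_mul (tendsto_coeff_C (hU k i))
    (tendsto_coeff_subst hU (fun t => hA t k) (hB k) (hAB k))

lemma tendsto_coeffs_iff {ι : Type*} {G : Filter ι}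
    {A : ι → Fin 3 → MvPolynomial (Fin 3) ℂ} {B : Fin 3 → MvPolynomial (Fin 3) ℂ} :
    Tendsto (fun t => coeffs (A t)) G (𝓝 (coeffs B)) ↔
    ∀ i m, Tendsto (fun t => coeff m (A t i)) G (𝓝 (coeff m (B i))) := by
  simp only [tendsto_pi_nhds]
  exact Iff.rfl

lemma qr (M : Matrix (Fin 3) (Fin 3) ℂ) : ∃ T U : Matrix (Fin 3) (Fin 3) ℂ,
    U * star U = 1 ∧ M = T * U ∧ T 0 1 = 0 ∧ T 0 2 = 0 ∧ T 1 2 = 0 := by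
  let f : Fin 3 → EuclideanSpace ℂ (Fin 3) := fun i => WithLp.toLp 2 (M i)
  let b := InnerProductSpace.gramSchmidtOrthonormalBasis (𝕜 := ℂ) (by simp) f
  refine ⟨fun i j => inner ℂ (b j) (f i), fun j k => b j k, ?_, ?_, ?_, ?_, ?_⟩
  · ext i j
    have := orthonormal_iff_ite.1 b.orthonormal j i
    rw [PiLp.inner_apply] at this
    simp only [Matrix.mul_apply, Matrix.star_apply, Matrix.one_apply]
    simp only [RCLike.inner_apply] at this
    simp only [eq_comm (a := j)] at this
    exact this
  · ext i k
    have := congrArg (fun w : EuclideanSpace ℂ (Fin 3) => w k) (b.sum_repr' (f i))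
    simp only [Matrix.mul_apply]
    simp only [PiLp.smul_apply, smul_eq_mul, WithLp.ofLp_sum, Finset.sum_apply] at this
    exact this.symm
  all_goals exact InnerProductSpace.gramSchmidtOrthonormalBasis_inv_triangular _ _ (by decide)

lemma unitary_entry {U : Matrix (Fin 3) (Fin 3) ℂ} (h : U * star U = 1) (i j : Fin 3) :
    ‖U i j‖ ≤ 1 := by
  exact entry_norm_bound_of_unitary (Matrix.mem_unitaryGroup_iff.2 h) i j

lemma ultra_bdd {ι : Type*} (G : Ultrafilter ι) (f : ι → ℂ) (h : ∀ᶠ t in G, ‖f t‖ ≤ 1) :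
    ∃ l, Tendsto f G (𝓝 l) := by
  obtain ⟨l, -, hl⟩ := (isCompact_closedBall (0 : ℂ) 1).ultrafilter_le_nhds (G.map f) (by
    rw [le_principal_iff, Ultrafilter.mem_coe, Ultrafilter.mem_map]
    filter_upwards [h] with t ht
    simpa using ht)
  exact ⟨l, hl⟩

lemma ultra_dich {ι : Type*} (G : Ultrafilter ι) (f : ι → ℂ) :
    (∃ l, Tendsto f G (𝓝 l)) ∨
      (Tendsto (fun t => (f t)⁻¹) G (𝓝 0) ∧ ∀ᶠ t in G, f t ≠ 0) := by
  by_cases hf : ∃ l, Tendsto f G (𝓝 l)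
  · exact Or.inl hf
  right
  have hb : ∀ᶠ t in (G : Filter ι), ¬ ‖f t‖ ≤ 1 := by
    rw [Ultrafilter.eventually_not]
    exact fun h => hf (ultra_bdd G f h)
  have hne : ∀ᶠ t in (G : Filter ι), f t ≠ 0 := by
    filter_upwards [hb] with t ht h0
    apply ht; simp [h0]
  refine ⟨?_, hne⟩
  obtain ⟨l, hl⟩ := ultra_bdd G (fun t => (f t)⁻¹) (by
    filter_upwards [hb] with t ht
    rw [norm_inv]
    exact inv_le_one_of_one_le₀ (not_le.1 ht).le)
  by_cases h0 : l = 0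
  · rwa [h0] at hl
  · exact absurd ⟨l⁻¹, by simpa using hl.inv₀ h0⟩ hf

lemma borel_red {Om Ω' : Fin 3 → MvPolynomial (Fin 3) ℂ} (hom : ∀ i, (Om i).IsHomogeneous 4)
    (h : Ω' ∈ FClos 3 (OrbitOf Om)) :
    ∃ Ω'', LinConj3 Ω'' Ω' ∧ IsFolDeg 3 Ω'' ∧
    ∃ (ι : Type) (G : Ultrafilter ι) (T : ι → Matrix (Fin 3) (Fin 3) ℂ) (c : ι → ℂ),
      (∀ t, T t 0 1 = 0 ∧ T t 0 2 = 0 ∧ T t 1 2 = 0 ∧ (T t).det ≠ 0 ∧ c t ≠ 0) ∧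
      ∀ i m, Tendsto (fun t => coeff m (C (c t) * pb3 (T t) Om i)) G (𝓝 (coeff m (Ω'' i))) := by
  obtain ⟨hF, hcl⟩ := h
  obtain ⟨G0, hG0, hG1⟩ := mem_closure_iff_ultrafilter.1 hcl
  let S : Set (Fin 3 → MvPolynomial (Fin 3) ℂ) := OrbitOf Om
  have hGc : (Filter.comap (fun t : S => coeffs t.1) (G0 : Filter _)).NeBot := by
    rw [Filter.comap_neBot_iff]
    intro s hs
    have : (s ∩ coeffs '' S).Nonempty :=
      Filter.nonempty_of_mem (f := (G0 : Filter _)) (Filter.inter_mem hs hG0)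
    obtain ⟨_, h1, a, ha, rfl⟩ := this
    exact ⟨⟨a, ha⟩, h1⟩
  let G : Ultrafilter S := Ultrafilter.of (Filter.comap (fun t : S => coeffs t.1) (G0 : Filter _))
  have hlim : Tendsto (fun t : S => coeffs t.1) G (𝓝 (coeffs Ω')) := by
    refine le_trans (Filter.map_mono (Ultrafilter.of_le _)) (le_trans Filter.map_comap_le hG1)
  have hex : ∀ t : S, ∃ T U : Matrix (Fin 3) (Fin 3) ℂ, ∃ c : ℂ, U * star U = 1 ∧
      (T 0 1 = 0 ∧ T 0 2 = 0 ∧ T 1 2 = 0 ∧ T.det ≠ 0 ∧ c ≠ 0) ∧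
      pb3 (star U) t.1 = fun i => C c * pb3 T Om i := by
    rintro ⟨A, M, c, hM, hc, hA⟩
    obtain ⟨T, U, hU, rfl, h1, h2, h3⟩ := qr M
    refine ⟨T, U, c⁻¹, hU, ⟨h1, h2, h3, ?_, inv_ne_zero hc⟩, ?_⟩
    · intro h0
      rw [Matrix.det_mul, h0] at hM
      simp at hM
    · have hB : A = fun i => C c⁻¹ * pb3 (T * U) Om i := by
        rw [hA]; funext i; simp [← mul_assoc, ← C_mul, hc]
      show pb3 (star U) A = _
      rw [hB, pb3_smul, ← pb3_mul, mul_assoc, hU, mul_one]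
  choose T U c hU hT hpb using hex
  have hUl : ∀ i j, ∃ l, Tendsto (fun t => U t i j) G (𝓝 l) := fun i j =>
    ultra_bdd G _ (Filter.Eventually.of_forall fun t => unitary_entry (hU t) i j)
  choose V hV using hUl
  have hVV : (Matrix.of V) * star (Matrix.of V) = 1 := by
    ext i j
    refine tendsto_nhds_unique (f := fun t => (U t * star (U t)) i j) (l := (G : Filter S)) ?_ ?_
    · simp only [Matrix.mul_apply, Matrix.star_apply, Matrix.of_apply]
      exact tendsto_finsetSum _ fun k _ => (hV i k).mul ((hV j k).star)
    · simp only [hU]; exact tendsto_const_nhds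
  have hdet : IsUnit (star (Matrix.of V)).det := by
    have := congrArg Matrix.det hVV
    rw [Matrix.det_mul, Matrix.det_one] at this
    exact IsUnit.of_mul_eq_one_right _ this
  have hconj : LinConj3 Ω' (pb3 (star (Matrix.of V)) Ω') :=
    ⟨star (Matrix.of V), 1, hdet, one_ne_zero, by simp⟩
  refine ⟨pb3 (star (Matrix.of V)) Ω', hconj.symm, isFol_of_conj hconj hF, S, G, T, c, hT, ?_⟩
  have hhom : ∀ (t : S) i, (t.1 i).IsHomogeneous 4 := by
    rintro ⟨A, M, c, hM, hc, hA⟩ i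
    have hB : A = fun i => C c⁻¹ * pb3 M Om i := by
      rw [hA]; funext i; simp [← mul_assoc, ← C_mul, hc]
    simp only [hB]
    simpa using (isHomogeneous_C (Fin 3) c⁻¹).mul (pb3_hom M hom i)
  have := tendsto_coeffs_pb (G := (G : Filter S)) (U := fun t => star (U t))
    (V := star (Matrix.of V)) (fun i j => (hV j i).star) (A := fun t => t.1) (B := Ω')
    hhom hF.2.1 (tendsto_coeffs_iff.1 hlim)
  intro i m
  have h2 := this i m
  simp only [hpb] at h2
  exact h2

end

section

open Filter Topology

/-- exponent vector -/
def e3 (a b c : ℕ) : Fin 3 →₀ ℕ :=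
  Finsupp.single 0 a + Finsupp.single 1 b + Finsupp.single 2 c

lemma e3_inj (a b c a' b' c' : ℕ) : e3 a b c = e3 a' b' c' ↔ a = a' ∧ b = b' ∧ c = c' := by
  constructor
  · intro h
    have h0 := DFunLike.congr_fun h 0
    have h1 := DFunLike.congr_fun h 1
    have h2 := DFunLike.congr_fun h 2
    simp [e3] at h0 h1 h2
    exact ⟨h0, h1, h2⟩
  · rintro ⟨rfl, rfl, rfl⟩; rfl

/-- binary cubic in x, y -/
def Pf (p : Fin 4 → ℂ) : MvPolynomial (Fin 3) ℂ :=
  monomial (e3 0 3 0) (p 0) + monomial (e3 1 2 0) (p 1) + monomial (e3 2 1 0) (p 2)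
    + monomial (e3 3 0 0) (p 3)

/-- ternary cubic -/
def Qf (q : Fin 10 → ℂ) : MvPolynomial (Fin 3) ℂ :=
  monomial (e3 0 0 3) (q 0) + monomial (e3 1 0 2) (q 1) + monomial (e3 0 1 2) (q 2)
    + monomial (e3 2 0 1) (q 3) + monomial (e3 1 1 1) (q 4) + monomial (e3 0 2 1) (q 5)
    + monomial (e3 0 3 0) (q 6) + monomial (e3 1 2 0) (q 7) + monomial (e3 2 1 0) (q 8)
    + monomial (e3 3 0 0) (q 9)

/-- the form `P e₂ + Q e₃` -/
def Om (P Q : MvPolynomial (Fin 3) ℂ) : Fin 3 → MvPolynomial (Fin 3) ℂ :=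
  ![X 2 * P - X 1 * Q, X 0 * Q, -(X 0 * P)]

lemma eval_e3 (a b c : ℕ) (k x y z : ℂ) :
    eval ![x, y, z] (monomial (e3 a b c) k) = k * x ^ a * y ^ b * z ^ c := by
  simp [eval_monomial, e3, Finsupp.prod_fintype, Fin.prod_univ_three, mul_assoc]

lemma eval_Pf (p : Fin 4 → ℂ) (x y z : ℂ) : eval ![x, y, z] (Pf p) =
    p 0 * y ^ 3 + p 1 * (x * y ^ 2) + p 2 * (x ^ 2 * y) + p 3 * x ^ 3 := by
  simp only [Pf, map_add, eval_e3]; ring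

lemma eval_Qf (q : Fin 10 → ℂ) (x y z : ℂ) : eval ![x, y, z] (Qf q) =
    q 0 * z ^ 3 + q 1 * (x * z ^ 2) + q 2 * (y * z ^ 2) + q 3 * (x ^ 2 * z) + q 4 * (x * y * z)
    + q 5 * (y ^ 2 * z) + q 6 * y ^ 3 + q 7 * (x * y ^ 2) + q 8 * (x ^ 2 * y) + q 9 * x ^ 3 := by
  simp only [Qf, map_add, eval_e3]; ring

lemma coeff_Pf (p : Fin 4 → ℂ) : coeff (e3 0 3 0) (Pf p) = p 0 ∧ coeff (e3 1 2 0) (Pf p) = p 1 ∧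
    coeff (e3 2 1 0) (Pf p) = p 2 ∧ coeff (e3 3 0 0) (Pf p) = p 3 := by
  simp [Pf, coeff_monomial, e3_inj]

lemma coeff_Qf (q : Fin 10 → ℂ) : coeff (e3 0 0 3) (Qf q) = q 0 ∧ coeff (e3 1 0 2) (Qf q) = q 1 ∧
    coeff (e3 0 1 2) (Qf q) = q 2 ∧ coeff (e3 2 0 1) (Qf q) = q 3 ∧ coeff (e3 1 1 1) (Qf q) = q 4 ∧
    coeff (e3 0 2 1) (Qf q) = q 5 ∧ coeff (e3 0 3 0) (Qf q) = q 6 ∧ coeff (e3 1 2 0) (Qf q) = q 7 ∧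
    coeff (e3 2 1 0) (Qf q) = q 8 ∧ coeff (e3 3 0 0) (Qf q) = q 9 := by
  simp [Qf, coeff_monomial, e3_inj]

lemma tendsto_coeff_mono {ι : Type*} {G : Filter ι} {f : ι → ℂ} {a : ℂ} (n : Fin 3 →₀ ℕ)
    (hf : Tendsto f G (𝓝 a)) (m : Fin 3 →₀ ℕ) :
    Tendsto (fun t => coeff m (monomial n (f t) : MvPolynomial (Fin 3) ℂ)) G
      (𝓝 (coeff m (monomial n a : MvPolynomial (Fin 3) ℂ))) := by
  simp only [coeff_monomial]
  split_ifs
  · exact hf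
  · exact tendsto_const_nhds

lemma tendsto_Om {ι : Type*} {G : Filter ι} {p : ι → Fin 4 → ℂ} {q : ι → Fin 10 → ℂ}
    {p' : Fin 4 → ℂ} {q' : Fin 10 → ℂ} (hp : ∀ k, Tendsto (fun t => p t k) G (𝓝 (p' k)))
    (hq : ∀ k, Tendsto (fun t => q t k) G (𝓝 (q' k))) (i : Fin 3) (m : Fin 3 →₀ ℕ) :
    Tendsto (fun t => coeff m (Om (Pf (p t)) (Qf (q t)) i)) G
      (𝓝 (coeff m (Om (Pf p') (Qf q') i))) := by
  have hP : ∀ m, Tendsto (fun t => coeff m (Pf (p t))) G (𝓝 (coeff m (Pf p'))) := by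
    intro m
    simp only [Pf, coeff_add]
    refine ((Tendsto.add ?_ ?_).add ?_).add ?_ <;> exact tendsto_coeff_mono _ (hp _) m
  have hQ : ∀ m, Tendsto (fun t => coeff m (Qf (q t))) G (𝓝 (coeff m (Qf q'))) := by
    intro m
    simp only [Qf, coeff_add]
    refine (((((((((Tendsto.add ?_ ?_).add ?_).add ?_).add ?_).add ?_).add ?_).add ?_).add ?_).add
      ?_) <;> exact tendsto_coeff_mono _ (hq _) m
  have hXP := fun k : Fin 3 => tendsto_coeff_mul (f := fun _ => (X k : MvPolynomial (Fin 3) ℂ))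
    (p := X k) (fun m => tendsto_const_nhds) hP
  have hXQ := fun k : Fin 3 => tendsto_coeff_mul (f := fun _ => (X k : MvPolynomial (Fin 3) ℂ))
    (p := X k) (fun m => tendsto_const_nhds) hQ
  fin_cases i
  · simpa [Om] using (hXP 2 m).sub (hXQ 1 m)
  · simpa [Om] using hXQ 0 m
  · simpa [Om] using (hXP 0 m).neg

lemma extract {ι : Type*} {G : Filter ι} [G.NeBot] {p : ι → Fin 4 → ℂ} {q : ι → Fin 10 → ℂ}
    {B : Fin 3 → MvPolynomial (Fin 3) ℂ}
    (h : ∀ i m, Tendsto (fun t => coeff m (Om (Pf (p t)) (Qf (q t)) i)) G (𝓝 (coeff m (B i)))) :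
    ∃ (p' : Fin 4 → ℂ) (q' : Fin 10 → ℂ), (∀ k, Tendsto (fun t => p t k) G (𝓝 (p' k))) ∧
      (∀ k, Tendsto (fun t => q t k) G (𝓝 (q' k))) ∧ B = Om (Pf p') (Qf q') := by
  have hp : ∀ k, ∃ l, Tendsto (fun t => p t k) G (𝓝 l) := by
    have key : ∀ m, ∃ l, Tendsto (fun t => coeff m (Pf (p t))) G (𝓝 l) := by
      intro m
      have := (h 2 (Finsupp.single 0 1 + m)).neg
      simp only [Om, Matrix.cons_val, coeff_neg, coeff_X_mul, neg_neg] at this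
      exact ⟨_, this⟩
    intro k
    fin_cases k
    · have h1 := key (e3 0 3 0); simp only [coeff_Pf] at h1; exact h1
    · have h1 := key (e3 1 2 0); simp only [coeff_Pf] at h1; exact h1
    · have h1 := key (e3 2 1 0); simp only [coeff_Pf] at h1; exact h1
    · have h1 := key (e3 3 0 0); simp only [coeff_Pf] at h1; exact h1
  have hq : ∀ k, ∃ l, Tendsto (fun t => q t k) G (𝓝 l) := by
    have key : ∀ m, ∃ l, Tendsto (fun t => coeff m (Qf (q t))) G (𝓝 l) := by
      intro m
      have := (h 1 (Finsupp.single 0 1 + m))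
      simp only [Om, Matrix.cons_val, coeff_X_mul] at this
      exact ⟨_, this⟩
    intro k
    fin_cases k
    · have h1 := key (e3 0 0 3); simp only [coeff_Qf] at h1; exact h1
    · have h1 := key (e3 1 0 2); simp only [coeff_Qf] at h1; exact h1
    · have h1 := key (e3 0 1 2); simp only [coeff_Qf] at h1; exact h1
    · have h1 := key (e3 2 0 1); simp only [coeff_Qf] at h1; exact h1
    · have h1 := key (e3 1 1 1); simp only [coeff_Qf] at h1; exact h1
    · have h1 := key (e3 0 2 1); simp only [coeff_Qf] at h1; exact h1
    · have h1 := key (e3 0 3 0); simp only [coeff_Qf] at h1; exact h1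
    · have h1 := key (e3 1 2 0); simp only [coeff_Qf] at h1; exact h1
    · have h1 := key (e3 2 1 0); simp only [coeff_Qf] at h1; exact h1
    · have h1 := key (e3 3 0 0); simp only [coeff_Qf] at h1; exact h1
  choose p' hp' using hp
  choose q' hq' using hq
  refine ⟨p', q', hp', hq', ?_⟩
  funext i
  ext m
  exact tendsto_nhds_unique (h i m) (tendsto_Om hp' hq' i m)

lemma not_fol {P Q : MvPolynomial (Fin 3) ℂ} (h : IsFolDeg 3 (Om P Q))
    (g : MvPolynomial (Fin 3) ℂ) (hg : eval ![0, 0, 0] g = 0) (hP : g ∣ P) (hQ : g ∣ Q) : False := by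
  have hu := h.2.2.2 g (by
    intro i
    fin_cases i
    · exact dvd_sub (hP.mul_left _) (hQ.mul_left _)
    · exact hQ.mul_left _
    · exact (hP.mul_left _).neg_right)
  have := hu.map (eval ![(0 : ℂ), 0, 0])
  rw [hg] at this
  exact not_isUnit_zero this

lemma not_fol_eval {P Q : MvPolynomial (Fin 3) ℂ} (h : IsFolDeg 3 (Om P Q))
    (g a b : MvPolynomial (Fin 3) ℂ) (hg : eval ![0, 0, 0] g = 0)
    (hP : ∀ x y z, eval ![x, y, z] P = eval ![x, y, z] g * eval ![x, y, z] a)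
    (hQ : ∀ x y z, eval ![x, y, z] Q = eval ![x, y, z] g * eval ![x, y, z] b) : False := by
  have hv : ∀ v : Fin 3 → ℂ, v = ![v 0, v 1, v 2] := by
    intro v; funext j; fin_cases j <;> rfl
  refine not_fol h g hg ⟨a, ?_⟩ ⟨b, ?_⟩ <;>
  · apply MvPolynomial.funext
    intro v
    rw [hv v, map_mul]
    apply_assumption

end

section

open Filter Topology

/-- coefficients of P in the Fermat family -/
def famP (a b u : ℂ) : Fin 4 → ℂ := ![b, 3 * b * u, 3 * b * u ^ 2 - a, b * u ^ 3 - a * u]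

/-- coefficients of Q in the Fermat family -/
def famQ (a b g u v w : ℂ) : Fin 10 → ℂ :=
  ![g, 3 * g * w, 3 * g * v, 3 * g * w ^ 2 - a, 6 * g * v * w, 3 * g * v ^ 2, g * v ^ 3 - v * b,
    3 * g * v ^ 2 * w - 3 * v * b * u, 3 * v * (g * w ^ 2 - b * u ^ 2),
    g * w ^ 3 - a * w - v * (b * u ^ 3 - a * u)]

lemma tl {ι : Type*} {G : Filter ι} {f g : ι → ℂ} {a b : ℂ} (h : Tendsto f G (𝓝 a))
    (hf : ∀ t, f t = g t) (hab : a = b) : Tendsto g G (𝓝 b) := by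
  rw [← hab]; exact h.congr hf

lemma lim_infmul {ι : Type*} {G : Filter ι} {f g : ι → ℂ} {l : ℂ}
    (hi : Tendsto (fun t => (f t)⁻¹) G (𝓝 0)) (hne : ∀ᶠ t in G, f t ≠ 0)
    (h : Tendsto (fun t => f t * g t) G (𝓝 l)) : Tendsto g G (𝓝 0) := by
  have := hi.mul h
  rw [zero_mul] at this
  refine this.congr' ?_
  filter_upwards [hne] with t ht
  field_simp

lemma limL {ι : Type*} {G : Filter ι} {b u a : ι → ℂ} {m n : ℂ}
    (hi : Tendsto (fun t => (u t)⁻¹) G (𝓝 0)) (hne : ∀ᶠ t in G, u t ≠ 0)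
    (h2 : Tendsto (fun t => 3 * b t * u t ^ 2 - a t) G (𝓝 m))
    (h3 : Tendsto (fun t => b t * u t ^ 3 - a t * u t) G (𝓝 n)) :
    Tendsto a G (𝓝 (m / 2)) ∧ Tendsto (fun t => b t * u t ^ 2) G (𝓝 (m / 2)) ∧
    Tendsto (fun t => b t * u t) G (𝓝 0) ∧ Tendsto b G (𝓝 0) := by
  have k1 : Tendsto (fun t => b t * u t ^ 2 - a t) G (𝓝 0) :=
    lim_infmul hi hne (tl h3 (fun t => by ring) rfl)
  have k2 : Tendsto (fun t => b t * u t ^ 2) G (𝓝 (m / 2)) :=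
    tl ((h2.sub k1).div_const 2) (fun t => by ring) (by ring)
  have k3 : Tendsto (fun t => b t * u t) G (𝓝 0) :=
    lim_infmul hi hne (tl k2 (fun t => by ring) rfl)
  have k4 : Tendsto b G (𝓝 0) :=
    lim_infmul hi hne (tl k3 (fun t => by ring) rfl)
  exact ⟨tl (k2.sub k1) (fun t => by ring) (by ring), k2, k3, k4⟩

lemma fun4 {p q : Fin 4 → ℂ} (h0 : p 0 = q 0) (h1 : p 1 = q 1) (h2 : p 2 = q 2) (h3 : p 3 = q 3) :
    p = q := by
  funext k; fin_cases k <;> assumption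

lemma fun10 {p q : Fin 10 → ℂ} (h0 : p 0 = q 0) (h1 : p 1 = q 1) (h2 : p 2 = q 2) (h3 : p 3 = q 3)
    (h4 : p 4 = q 4) (h5 : p 5 = q 5) (h6 : p 6 = q 6) (h7 : p 7 = q 7) (h8 : p 8 = q 8)
    (h9 : p 9 = q 9) : p = q := by
  funext k; fin_cases k <;> assumption

/-- list of possible limits -/
def LimShape (p : Fin 4 → ℂ) (q : Fin 10 → ℂ) : Prop :=
  (∃ a b g u v w, p = famP a b u ∧ q = famQ a b g u v w) ∨
  (∃ a b u v s, p = famP a b u ∧ q = ![0, 0, 0, 2 * a, 0, 0, -(v * b), -(3 * v * b * u),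
    3 * v * (a - b * u ^ 2), s]) ∨
  (∃ a g v w s, p = ![0, 0, 2 * a, s] ∧ q = ![g, 3 * g * w, 3 * g * v, 3 * g * w ^ 2 - a,
    6 * g * v * w, 3 * g * v ^ 2, g * v ^ 3, 3 * g * v ^ 2 * w, 3 * v * (g * w ^ 2 - a),
    g * w ^ 3 - a * w - v * s]) ∨
  (∃ a b u w r, p = famP a b u ∧ q = ![0, 0, 0, 3 * b * u ^ 2 - a, 6 * b * u, 3 * b, r,
    3 * b * w + 3 * r * u, 6 * b * w * u + 3 * r * u ^ 2,
    3 * b * w * u ^ 2 + r * u ^ 3 - a * w]) ∨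
  p = 0 ∨ (p 0 = 0 ∧ q 0 = 0 ∧ q 2 = 0 ∧ q 5 = 0 ∧ q 6 = 0)

lemma fermat_limits {ι : Type*} (G : Ultrafilter ι) (α β γ u v w : ι → ℂ) (p : Fin 4 → ℂ)
    (q : Fin 10 → ℂ) (hp : ∀ k, Tendsto (fun t => famP (α t) (β t) (u t) k) G (𝓝 (p k)))
    (hq : ∀ k, Tendsto (fun t => famQ (α t) (β t) (γ t) (u t) (v t) (w t) k) G (𝓝 (q k))) :
    LimShape p q := by
  have p0 := hp 0
  have p1 := hp 1
  have p2 := hp 2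
  have p3 := hp 3
  have q0 := hq 0
  have q1 := hq 1
  have q2 := hq 2
  have q3 := hq 3
  have q4 := hq 4
  have q5 := hq 5
  have q6 := hq 6
  have q7 := hq 7
  have q8 := hq 8
  have q9 := hq 9
  clear hp hq
  simp only [famP, famQ, Matrix.cons_val] at p0 p1 p2 p3 q0 q1 q2 q3 q4 q5 q6 q7 q8 q9
  have uq : ∀ {f : ι → ℂ} {a b : ℂ}, Tendsto f G (𝓝 a) → Tendsto f G (𝓝 b) → a = b :=
    fun h1 h2 => tendsto_nhds_unique h1 h2
  rcases ultra_dich G v with ⟨v', hv⟩ | ⟨hvi, hvn⟩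
  · rcases ultra_dich G u with ⟨u', hu⟩ | ⟨hui, hun⟩
    · have ha : Tendsto α G (𝓝 (3 * p 0 * u' ^ 2 - p 2)) :=
        tl (((p0.const_mul 3).mul (hu.pow 2)).sub p2) (fun t => by ring) rfl
      have hP : p = famP (3 * p 0 * u' ^ 2 - p 2) (p 0) u' := by
        refine fun4 rfl ?_ ?_ ?_
        · exact uq p1 ((p0.const_mul 3).mul hu)
        · exact uq p2 (((p0.const_mul 3).mul (hu.pow 2)).sub ha)
        · exact uq p3 ((p0.mul (hu.pow 3)).sub (ha.mul hu))
      rcases ultra_dich G w with ⟨w', hw⟩ | ⟨hwi, hwn⟩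
      · left
        refine ⟨_, p 0, q 0, u', v', w', hP, ?_⟩
        refine fun10 rfl ?_ ?_ ?_ ?_ ?_ ?_ ?_ ?_ ?_
        · exact uq q1 ((q0.const_mul 3).mul hw)
        · exact uq q2 ((q0.const_mul 3).mul hv)
        · exact uq q3 (((q0.const_mul 3).mul (hw.pow 2)).sub ha)
        · exact uq q4 (((q0.const_mul 6).mul hv).mul hw)
        · exact uq q5 ((q0.const_mul 3).mul (hv.pow 2))
        · exact uq q6 ((q0.mul (hv.pow 3)).sub (hv.mul p0))
        · exact uq q7 ((((q0.const_mul 3).mul (hv.pow 2)).mul hw).sub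
            (((hv.const_mul 3).mul p0).mul hu))
        · exact uq q8 ((hv.const_mul 3).mul ((q0.mul (hw.pow 2)).sub (p0.mul (hu.pow 2))))
        · exact uq q9 (((q0.mul (hw.pow 3)).sub (ha.mul hw)).sub
            (hv.mul ((p0.mul (hu.pow 3)).sub (ha.mul hu))))
      · right; left
        obtain ⟨k1, k2, k3, k4⟩ := limL (b := γ) (a := α) hwi hwn q3
          (tl (q9.add (hv.mul p3)) (fun t => by ring) rfl)
        have hg := uq q0 k4
        have haa := uq ha k1
        refine ⟨_, p 0, u', v', q 9, hP, ?_⟩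
        rw [haa]
        refine fun10 hg ?_ ?_ ?_ ?_ ?_ ?_ ?_ ?_ rfl
        · exact uq q1 (tl (k3.const_mul 3) (fun t => by ring) (by simp))
        · exact uq q2 (tl ((k4.const_mul 3).mul hv) (fun t => by ring) (by simp))
        · show q 3 = 2 * (q 3 / 2); ring
        · exact uq q4 (tl ((k3.const_mul 6).mul hv) (fun t => by ring) (by simp))
        · exact uq q5 (tl ((k4.const_mul 3).mul (hv.pow 2)) (fun t => by ring) (by simp))
        · exact uq q6 (tl ((k4.mul (hv.pow 3)).sub (hv.mul p0)) (fun t => by ring) (by simp))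
        · exact uq q7 (tl (((k3.const_mul 3).mul (hv.pow 2)).sub
            (((hv.const_mul 3).mul p0).mul hu)) (fun t => by ring) (by simp))
        · exact uq q8 ((hv.const_mul 3).mul (k2.sub (p0.mul (hu.pow 2))))
    · obtain ⟨k1, k2, k3, k4⟩ := limL (b := β) (a := α) hui hun p2 p3
      have hb := uq p0 k4
      rcases ultra_dich G w with ⟨w', hw⟩ | ⟨hwi, hwn⟩
      · right; right; left
        refine ⟨p 2 / 2, q 0, v', w', p 3, fun4 hb ?_ ?_ rfl, ?_⟩
        · exact uq p1 (tl (k3.const_mul 3) (fun t => by ring) (by simp))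
        · show p 2 = 2 * (p 2 / 2); ring
        refine fun10 rfl ?_ ?_ ?_ ?_ ?_ ?_ ?_ ?_ ?_
        · exact uq q1 ((q0.const_mul 3).mul hw)
        · exact uq q2 ((q0.const_mul 3).mul hv)
        · exact uq q3 (((q0.const_mul 3).mul (hw.pow 2)).sub k1)
        · exact uq q4 (((q0.const_mul 6).mul hv).mul hw)
        · exact uq q5 ((q0.const_mul 3).mul (hv.pow 2))
        · exact uq q6 (tl ((q0.mul (hv.pow 3)).sub (hv.mul k4)) (fun t => by ring) (by simp))
        · exact uq q7 (tl ((((q0.const_mul 3).mul (hv.pow 2)).mul hw).sub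
            ((hv.const_mul 3).mul k3)) (fun t => by ring) (by simp))
        · exact uq q8 ((hv.const_mul 3).mul ((q0.mul (hw.pow 2)).sub k2))
        · exact uq q9 (((q0.mul (hw.pow 3)).sub (k1.mul hw)).sub (hv.mul p3))
      · right; right; right; right; right
        obtain ⟨l1, l2, l3, l4⟩ := limL (b := γ) (a := α) hwi hwn q3
          (tl (q9.add (hv.mul p3)) (fun t => by ring) rfl)
        refine ⟨hb, uq q0 l4, ?_, ?_, ?_⟩
        · exact uq q2 (tl ((l4.const_mul 3).mul hv) (fun t => by ring) (by simp))
        · exact uq q5 (tl ((l4.const_mul 3).mul (hv.pow 2)) (fun t => by ring) (by simp))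
        · exact uq q6 (tl ((l4.mul (hv.pow 3)).sub (hv.mul k4)) (fun t => by ring) (by simp))
  · have m1 : Tendsto (fun t => γ t * v t ^ 2 - β t) G (𝓝 0) :=
      lim_infmul hvi hvn (tl q6 (fun t => by ring) rfl)
    have m2 : Tendsto (fun t => γ t * v t ^ 2) G (𝓝 (p 0)) :=
      tl (m1.add p0) (fun t => by ring) (by ring)
    have m3 : Tendsto (fun t => γ t * v t) G (𝓝 0) :=
      lim_infmul hvi hvn (tl m2 (fun t => by ring) rfl)
    have m4 : Tendsto γ G (𝓝 0) :=
      lim_infmul hvi hvn (tl m3 (fun t => by ring) rfl)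
    have z0 := uq q0 m4
    have z2 : q 2 = 0 := uq q2 (tl (m3.const_mul 3) (fun t => by ring) (by simp))
    have z5 : q 5 = 3 * p 0 := uq q5 (tl (m2.const_mul 3) (fun t => by ring) (by simp))
    rcases ultra_dich G u with ⟨u', hu⟩ | ⟨hui, hun⟩
    · have ha : Tendsto α G (𝓝 (3 * p 0 * u' ^ 2 - p 2)) :=
        tl (((p0.const_mul 3).mul (hu.pow 2)).sub p2) (fun t => by ring) rfl
      have hP : p = famP (3 * p 0 * u' ^ 2 - p 2) (p 0) u' := by
        refine fun4 rfl ?_ ?_ ?_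
        · exact uq p1 ((p0.const_mul 3).mul hu)
        · exact uq p2 (((p0.const_mul 3).mul (hu.pow 2)).sub ha)
        · exact uq p3 ((p0.mul (hu.pow 3)).sub (ha.mul hu))
      generalize 3 * p 0 * u' ^ 2 - p 2 = a at ha hP
      have B1 : Tendsto (fun t => γ t * v t ^ 2 * (w t - u t * v t)) G
          (𝓝 ((q 7 - 3 * u' * q 6) / 3)) :=
        tl ((q7.sub ((hu.const_mul 3).mul q6)).div_const 3) (fun t => by ring) rfl
      have B2 : Tendsto (fun t => v t * (γ t * (w t - u t * v t) ^ 2)) G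
          (𝓝 ((q 8 - 2 * u' * q 7 + 3 * u' ^ 2 * q 6) / 3)) :=
        tl (((q8.sub ((hu.const_mul 2).mul q7)).add (((hu.pow 2).const_mul 3).mul q6)).div_const 3)
          (fun t => by ring) rfl
      have B3 : Tendsto (fun t => (w t - u t * v t) * (γ t * (w t - u t * v t) ^ 2 - α t)) G
          (𝓝 (q 9 - u' * q 8 + u' ^ 2 * q 7 - u' ^ 3 * q 6)) :=
        tl (((q9.sub (hu.mul q8)).add ((hu.pow 2).mul q7)).sub ((hu.pow 3).mul q6))
          (fun t => by ring) rfl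
      have B4 : Tendsto (fun t => γ t * (w t - u t * v t) ^ 2) G (𝓝 0) := lim_infmul hvi hvn B2
      have hdiv : ∀ {f g : ι → ℂ} {a b : ℂ}, Tendsto (fun t => f t * g t) G (𝓝 a) →
          Tendsto g G (𝓝 b) → b ≠ 0 → ∃ l, Tendsto f G (𝓝 l) := by
        intro f g a b h1 h2 hb
        refine ⟨a / b, (h1.div h2 hb).congr' ?_⟩
        filter_upwards [h2.eventually_ne hb] with t ht
        exact mul_div_cancel_right₀ _ ht
      have hex : (a = 0 ∧ p 0 = 0) ∨ ∃ l, Tendsto (fun t => w t - u t * v t) G (𝓝 l) := by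
        by_cases hb : p 0 = 0
        · by_cases ha0 : a = 0
          · exact Or.inl ⟨ha0, hb⟩
          · right
            exact hdiv B3 (B4.sub ha) (by simpa using ha0)
        · right
          exact hdiv (tl B1 (fun t => by ring) rfl) m2 hb
      rcases hex with ⟨ha0, hb0⟩ | ⟨l, hl⟩
      · right; right; right; right; left
        rw [hP, ha0, hb0]
        refine fun4 ?_ ?_ ?_ ?_ <;> simp [famP]
      · right; right; right; left
        have c7 := uq B1 (m2.mul hl)
        have c8 := uq B2 (tl (m3.mul (hl.pow 2)) (fun t => by ring) rfl)
        have c9 := uq B3 (hl.mul (B4.sub ha))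
        have d7 : q 7 = 3 * p 0 * l + 3 * q 6 * u' := by linear_combination 3 * c7
        have d8 : q 8 = 6 * p 0 * l * u' + 3 * q 6 * u' ^ 2 := by
          linear_combination 3 * c8 + 2 * u' * d7
        refine ⟨a, p 0, u', l, q 6, hP, ?_⟩
        refine fun10 z0 ?_ z2 ?_ ?_ z5 rfl d7 d8 ?_
        · exact uq q1 (tl (((m4.mul hl).const_mul 3).add ((hu.const_mul 3).mul m3))
            (fun t => by ring) (by simp))
        · exact uq q3 (tl (((B4.const_mul 3).add (((hu.const_mul 6).mul m3).mul hl)).add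
            (((m2.const_mul 3).mul (hu.pow 2)).sub ha)) (fun t => by ring)
            (by show _ = 3 * p 0 * u' ^ 2 - a; ring))
        · exact uq q4 (tl (((m3.const_mul 6).mul hl).add ((m2.const_mul 6).mul hu))
            (fun t => by ring) (by show _ = 6 * p 0 * u'; ring))
        · show q 9 = 3 * p 0 * l * u' ^ 2 + q 6 * u' ^ 3 - a * l
          linear_combination c9 + u' * d8 - u' ^ 2 * d7
    · obtain ⟨k1, k2, k3, k4⟩ := limL (b := β) (a := α) hui hun p2 p3
      have hb := uq p0 k4
      by_cases hr : q 6 = 0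
      · right; right; right; right; right
        exact ⟨hb, z0, z2, by rw [z5, hb, mul_zero], hr⟩
      have hA : Tendsto (fun t => v t * (γ t * v t * w t - β t * u t)) G (𝓝 (q 7 / 3)) :=
        tl (q7.div_const 3) (fun t => by ring) rfl
      have hE : Tendsto (fun t => v t * (γ t * w t ^ 2 - β t * u t ^ 2)) G (𝓝 (q 8 / 3)) :=
        tl (q8.div_const 3) (fun t => by ring) rfl
      rcases ultra_dich G (fun t => w t / v t) with ⟨l, hl⟩ | ⟨hfi, hfn⟩
      · right; right; right; right; left
        have n1 : Tendsto (fun t => γ t * w t ^ 2) G (𝓝 0) := by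
          have := (hl.pow 2).mul m2
          rw [hb, mul_zero] at this
          refine this.congr' ?_
          filter_upwards [hvn] with t ht
          field_simp
        have n2 := lim_infmul hvi hvn hE
        have n3 : p 2 / 2 = 0 := by
          have := uq (n1.sub n2) (tl k2 (fun t => by ring) rfl)
          rw [← this]; ring
        have n4 : p 3 = 0 := by
          have h1 := hvi.mul q9
          have h2 := (hl.mul (n1.sub k1)).sub p3
          have h3 := uq h1 (h2.congr' (by
            filter_upwards [hvn] with t ht
            field_simp))
          rw [n3] at h3
          linear_combination h3
        refine fun4 hb ?_ ?_ n4
        · exact uq p1 (tl (k3.const_mul 3) (fun t => by ring) (by simp))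
        · show p 2 = 0
          linear_combination 2 * n3
      · exfalso
        apply hr
        have h1 := (hA.sub (hfi.mul hE)).mul hui
        have h2 := q6.sub (hfi.mul hA)
        have h3 := uq h1 (h2.congr' (by
          filter_upwards [hvn, hfn, hun] with t ht1 ht2 ht3
          have hw : w t ≠ 0 := by
            intro h; apply ht2; simp [h]
          field_simp
          ring))
        linear_combination -h3

end

section

open Filter Topology

lemma sqr (a : ℂ) : ∃ k, a = k ^ 2 := by
  obtain ⟨k, hk⟩ := IsAlgClosed.exists_pow_nat_eq a (n := 2) (by norm_num)
  exact ⟨k, hk.symm⟩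

lemma isfol_x {p : Fin 4 → ℂ} {q : Fin 10 → ℂ} (h : IsFolDeg 3 (Om (Pf p) (Qf q)))
    (h0 : p 0 = 0) (h1 : q 0 = 0) (h2 : q 2 = 0) (h3 : q 5 = 0) (h4 : q 6 = 0) : False := by
  refine not_fol_eval h (X 0) (C (p 1) * X 1 ^ 2 + C (p 2) * X 0 * X 1 + C (p 3) * X 0 ^ 2)
    (C (q 1) * X 2 ^ 2 + C (q 3) * X 0 * X 2 + C (q 4) * X 1 * X 2 + C (q 7) * X 1 ^ 2
      + C (q 8) * X 0 * X 1 + C (q 9) * X 0 ^ 2) (by simp) ?_ ?_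
  · intro x y z
    simp [eval_Pf, h0]; ring
  · intro x y z
    simp [eval_Qf, h1, h2, h3, h4]; ring

lemma isfol_p {q : Fin 10 → ℂ} (h : IsFolDeg 3 (Om (Pf 0) (Qf q))) : False := by
  refine not_fol_eval h (Qf q) 0 1 (by simp [eval_Qf]) ?_ ?_
  · intro x y z
    simp [eval_Pf]
  · intro x y z
    simp

lemma isfol_Y {p : Fin 4 → ℂ} {q : Fin 10 → ℂ} (h : IsFolDeg 3 (Om (Pf p) (Qf q)))
    (u a b c d e f g i j : ℂ)
    (hp : p = ![a, b + u * a, c + u * b, u * c])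
    (hq : q = ![0, d * u, d, f * u, f + e * u, e, g, i + g * u, j + i * u, j * u]) : False := by
  refine not_fol_eval h (X 1 + C u * X 0) (C a * X 1 ^ 2 + C b * X 0 * X 1 + C c * X 0 ^ 2)
    (C d * X 2 ^ 2 + C e * X 1 * X 2 + C f * X 0 * X 2 + C g * X 1 ^ 2 + C i * X 0 * X 1
      + C j * X 0 ^ 2) (by simp) ?_ ?_
  · intro x y z
    simp [eval_Pf, hp]; ring
  · intro x y z
    simp [eval_Qf, hq]; ring

lemma fam_conj {T : Matrix (Fin 3) (Fin 3) ℂ} (c : ℂ) (h01 : T 0 1 = 0) (h02 : T 0 2 = 0)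
    (h12 : T 1 2 = 0) (hd : T.det ≠ 0) : (fun i => C c * pb3 T OmF3 i) =
    Om (Pf (famP (-(c * (T 0 0 * T 1 1 * T 2 2) * T 0 0 ^ 2))
      (-(c * (T 0 0 * T 1 1 * T 2 2) * T 1 1 ^ 2)) (T 1 0 / T 1 1)))
      (Qf (famQ (-(c * (T 0 0 * T 1 1 * T 2 2) * T 0 0 ^ 2))
      (-(c * (T 0 0 * T 1 1 * T 2 2) * T 1 1 ^ 2)) (-(c * (T 0 0 * T 1 1 * T 2 2) * T 2 2 ^ 2))
       (T 1 0 / T 1 1) (T 2 1 / T 2 2) (T 2 0 / T 2 2))) := by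
  rw [Matrix.det_fin_three, h01, h02, h12] at hd
  have h1 : T 1 1 ≠ 0 := by intro h; apply hd; rw [h]; ring
  have h2 : T 2 2 ≠ 0 := by intro h; apply hd; rw [h]; ring
  have hv : ∀ v : Fin 3 → ℂ, v = ![v 0, v 1, v 2] := by
    intro v; funext j; fin_cases j <;> rfl
  obtain ⟨u, hu⟩ : ∃ u, u = T 1 0 / T 1 1 := ⟨_, rfl⟩
  obtain ⟨v, hv'⟩ : ∃ u, u = T 2 1 / T 2 2 := ⟨_, rfl⟩
  obtain ⟨w, hw⟩ : ∃ u, u = T 2 0 / T 2 2 := ⟨_, rfl⟩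
  rw [← hu, ← hv', ← hw]
  have h10 : T 1 0 = u * T 1 1 := by rw [hu]; field_simp
  have h21 : T 2 1 = v * T 2 2 := by rw [hv']; field_simp
  have h20 : T 2 0 = w * T 2 2 := by rw [hw]; field_simp
  funext i
  apply MvPolynomial.funext
  intro x
  rw [hv x]
  generalize x 0 = x0
  generalize x 1 = x1
  generalize x 2 = x2
  fin_cases i <;>
  · simp [eval_pb3, Fin.sum_univ_three, Om, eval_Pf, eval_Qf, famP, famQ, OmF3, Matrix.mulVec,
      dotProduct, h01, h02, h12, h10, h20, h21]
    ring

end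

section

open Filter Topology

section memb

lemma c1_all (a b c u v w : ℂ) (ha : a ≠ 0) (hb : b ≠ 0) (hc : c ≠ 0) :
    LinConj3 OmF3 (Om (Pf (famP (a ^ 2) (b ^ 2) u)) (Qf (famQ (a ^ 2) (b ^ 2) (c ^ 2) u v w))) := by
  refine linConj3_of_eval !![a, 0, 0; b * u, b, 0; c * w, c * v, c] (-(a * b * c)) ?_
    (by simp [ha, hb, hc]) ?_
  · simp [Matrix.det_fin_three, ha, hb, hc]
  · intro x y z i
    fin_cases i <;>
    · simp [Om, eval_Pf, eval_Qf, famP, famQ, OmF3]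
      ring

lemma c1_g (a b u v w : ℂ) (ha : a ≠ 0) (hb : b ≠ 0) :
    LinConj3 OmH1 (Om (Pf (famP (a ^ 2) (b ^ 2) u)) (Qf (famQ (a ^ 2) (b ^ 2) 0 u v w))) := by
  refine linConj3_of_eval !![a, 0, 0; b * u, b, 0; w, v, 1] (a * b) ?_
    (by simp [ha, hb]) ?_
  · simp [Matrix.det_fin_three, ha, hb]
  · intro x y z i
    fin_cases i <;>
    · simp [Om, eval_Pf, eval_Qf, famP, famQ, OmH1]
      ring

lemma c1_b (a c u v w : ℂ) (ha : a ≠ 0) (hc : c ≠ 0) :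
    LinConj3 OmH1 (Om (Pf (famP (a ^ 2) 0 u)) (Qf (famQ (a ^ 2) 0 (c ^ 2) u v w))) := by
  refine linConj3_of_eval !![c * w, c * v, c; a, 0, 0; u, 1, 0] (a * c) ?_
    (by simp [ha, hc]) ?_
  · simp [Matrix.det_fin_three, ha, hc]
  · intro x y z i
    fin_cases i <;>
    · simp [Om, eval_Pf, eval_Qf, famP, famQ, OmH1]
      ring

lemma c1_a (b c u v w : ℂ) (hb : b ≠ 0) (hc : c ≠ 0) :
    LinConj3 OmH1 (Om (Pf (famP 0 (b ^ 2) u)) (Qf (famQ 0 (b ^ 2) (c ^ 2) u v w))) := by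
  refine linConj3_of_eval !![b * u, b, 0; c * w, c * v, c; 1, 0, 0] (b * c) ?_
    (by simp [hb, hc]) ?_
  · simp [Matrix.det_fin_three, hb, hc]
  · intro x y z i
    fin_cases i <;>
    · simp [Om, eval_Pf, eval_Qf, famP, famQ, OmH1]
      ring

lemma c2_H3 (k l u v w : ℂ) (hk : k ≠ 0) (hl : l ≠ 0) :
    LinConj3 OmH3 (Om (Pf (famP (k ^ 2) (l ^ 2) u)) (Qf ![0, 0, 0, 2 * k ^ 2, 0, 0,
      -(v * l ^ 2), -(3 * v * l ^ 2 * u), 3 * v * (k ^ 2 - l ^ 2 * u ^ 2),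
      2 * k ^ 2 * w - v * (l ^ 2 * u ^ 3 - k ^ 2 * u)])) := by
  refine linConj3_of_eval !![k + l * u, l, 0; k - l * u, -l, 0; w, v, 1] (4 * k * l) ?_
    (by simp [hk, hl]) ?_
  · have : (-2 * k * l) ≠ 0 := by simp [hk, hl]
    convert this using 1
    simp [Matrix.det_fin_three]; ring
  · intro x y z i
    fin_cases i <;>
    · simp [Om, eval_Pf, eval_Qf, famP, famQ, OmH3]
      ring

lemma c2_F1 (m s u v : ℂ) (hm : m ≠ 0) (hs : s ≠ 0) :
    LinConj3 OmF1 (Om (Pf (famP 0 (m * s) u)) (Qf ![0, 0, 0, 0, 0, 0, -(v * (m * s)),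
      -(3 * v * (m * s) * u), 3 * v * (0 - (m * s) * u ^ 2), s - v * ((m * s) * u ^ 3)])) := by
  refine linConj3_of_eval !![1, 0, 0; u, 1, 0; 0, m * v, m] s⁻¹ ?_
    (by simp [hs]) ?_
  · simp [Matrix.det_fin_three, hm]
  · intro x y z i
    fin_cases i <;>
    · simp [Om, eval_Pf, eval_Qf, famP, famQ, OmF1]
      field_simp
      ring

lemma c3_H3 (k l r v w : ℂ) (hk : k ≠ 0) (hl : l ≠ 0) :
    LinConj3 OmH3 (Om (Pf ![0, 0, 2 * k ^ 2, 2 * k ^ 2 * r]) (Qf ![l ^ 2, 3 * l ^ 2 * w,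
      3 * l ^ 2 * v, 3 * l ^ 2 * w ^ 2 - k ^ 2,
      6 * l ^ 2 * v * w, 3 * l ^ 2 * v ^ 2, l ^ 2 * v ^ 3, 3 * l ^ 2 * v ^ 2 * w,
      3 * v * (l ^ 2 * w ^ 2 - k ^ 2),
      l ^ 2 * w ^ 3 - k ^ 2 * w - v * (2 * k ^ 2 * r)])) := by
  refine linConj3_of_eval !![k + l * w, l * v, l; k - l * w, -(l * v), -l; r, 1, 0] (-(4 * k * l)) ?_
    (by simp [hk, hl]) ?_
  · have : (2 * k * l) ≠ 0 := by simp [hk, hl]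
    convert this using 1
    simp [Matrix.det_fin_three]; ring
  · intro x y z i
    fin_cases i <;>
    · simp [Om, eval_Pf, eval_Qf, OmH3]
      ring

lemma c3_F1 (m s v w : ℂ) (hm : m ≠ 0) (hs : s ≠ 0) :
    LinConj3 OmF1 (Om (Pf ![0, 0, 2 * 0, s]) (Qf ![m * s, 3 * (m * s) * w,
      3 * (m * s) * v, 3 * (m * s) * w ^ 2 - 0,
      6 * (m * s) * v * w, 3 * (m * s) * v ^ 2, (m * s) * v ^ 3, 3 * (m * s) * v ^ 2 * w,
      3 * v * ((m * s) * w ^ 2 - 0), (m * s) * w ^ 3 - 0 * w - v * s])) := by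
  refine linConj3_of_eval !![1, 0, 0; w, v, 1; 0, m, 0] (-s⁻¹) ?_
    (by simp [hs]) ?_
  · simp [Matrix.det_fin_three, hm]
  · intro x y z i
    fin_cases i <;>
    · simp [Om, eval_Pf, eval_Qf, OmF1]
      field_simp
      try ring

lemma c4_H3 (k l u w r : ℂ) (hk : k ≠ 0) (hl : l ≠ 0) :
    LinConj3 OmH3 (Om (Pf (famP (l ^ 2) (k ^ 2) u)) (Qf ![0, 0, 0, 3 * k ^ 2 * u ^ 2 - l ^ 2,
      6 * k ^ 2 * u, 3 * k ^ 2, 2 * k ^ 2 * r,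
      3 * k ^ 2 * w + 3 * (2 * k ^ 2 * r) * u, 6 * k ^ 2 * w * u + 3 * (2 * k ^ 2 * r) * u ^ 2,
      3 * k ^ 2 * w * u ^ 2 + (2 * k ^ 2 * r) * u ^ 3 - l ^ 2 * w])) := by
  refine linConj3_of_eval !![k * u + l, k, 0; k * u - l, k, 0; w + r * u, r, 1] (-(4 * k * l)) ?_
    (by simp [hk, hl]) ?_
  · have : (2 * k * l) ≠ 0 := by simp [hk, hl]
    convert this using 1
    simp [Matrix.det_fin_three]; ring
  · intro x y z i
    fin_cases i <;>
    · simp [Om, eval_Pf, eval_Qf, famP, OmH3]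
      ring

lemma c4_F1 (m r u w : ℂ) (hm : m ≠ 0) (hr : r ≠ 0) :
    LinConj3 OmF1 (Om (Pf (famP (m * r) 0 u)) (Qf ![0, 0, 0, 3 * 0 * u ^ 2 - (m * r),
      6 * 0 * u, 3 * 0, r, 3 * 0 * w + 3 * r * u, 6 * 0 * w * u + 3 * r * u ^ 2,
      3 * 0 * w * u ^ 2 + r * u ^ 3 - (m * r) * w])) := by
  refine linConj3_of_eval !![u, 1, 0; 1, 0, 0; m * w, 0, m] (-r⁻¹) ?_
    (by simp [hr]) ?_
  · simp [Matrix.det_fin_three, hm]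
  · intro x y z i
    fin_cases i <;>
    · simp [Om, eval_Pf, eval_Qf, famP, OmF1]
      field_simp
      ring

end memb

end

section

open Filter Topology

/-- the target set -/
def Tgt (B : Fin 3 → MvPolynomial (Fin 3) ℂ) : Prop :=
  LinConj3 OmF1 B ∨ LinConj3 OmH1 B ∨ LinConj3 OmH3 B ∨ LinConj3 OmF3 B

lemma shape_tgt {p : Fin 4 → ℂ} {q : Fin 10 → ℂ} (h : IsFolDeg 3 (Om (Pf p) (Qf q)))
    (hs : LimShape p q) : Tgt (Om (Pf p) (Qf q)) := by
  rcases hs with ⟨a, b, g, u, v, w, rfl, rfl⟩ | ⟨a, b, u, v, s, rfl, rfl⟩ |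
    ⟨a, g, v, w, s, rfl, rfl⟩ | ⟨a, b, u, w, r, rfl, rfl⟩ | rfl | ⟨h0, h1, h2, h3, h4⟩
  · obtain ⟨a, rfl⟩ := sqr a
    obtain ⟨b, rfl⟩ := sqr b
    obtain ⟨g, rfl⟩ := sqr g
    by_cases ha : a = 0
    · subst ha
      by_cases hb : b = 0
      · subst hb
        exfalso
        have : famP (0 ^ 2) (0 ^ 2) u = 0 := by
          refine fun4 ?_ ?_ ?_ ?_ <;> simp [famP]
        rw [this] at h
        exact isfol_p h
      by_cases hg : g = 0
      · subst hg
        exfalso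
        refine isfol_Y h u (b ^ 2) (2 * b ^ 2 * u) (b ^ 2 * u ^ 2) 0 0 0 (-(v * b ^ 2))
          (-(2 * v * b ^ 2 * u)) (-(v * b ^ 2 * u ^ 2)) ?_ ?_
        · refine fun4 ?_ ?_ ?_ ?_ <;> simp [famP] <;> ring
        · refine fun10 ?_ ?_ ?_ ?_ ?_ ?_ ?_ ?_ ?_ ?_ <;> simp [famQ] <;> ring
      · right; left
        simpa using c1_a b g u v w hb hg
    · by_cases hb : b = 0
      · subst hb
        by_cases hg : g = 0
        · subst hg
          exfalso
          refine isfol_x h ?_ ?_ ?_ ?_ ?_ <;> simp [famP, famQ]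
        · right; left
          simpa using c1_b a g u v w ha hg
      · by_cases hg : g = 0
        · subst hg
          right; left
          simpa using c1_g a b u v w ha hb
        · right; right; right
          exact c1_all a b g u v w ha hb hg
  · obtain ⟨a, rfl⟩ := sqr a
    by_cases hb : b = 0
    · subst hb
      exfalso
      refine isfol_x h ?_ ?_ ?_ ?_ ?_ <;> simp [famP]
    by_cases ha : a = 0
    · subst ha
      by_cases hs : s + v * (b * u ^ 3) = 0
      · exfalso
        refine isfol_Y h u b (2 * b * u) (b * u ^ 2) 0 0 0 (-(v * b))
          (-(2 * v * b * u)) (-(v * b * u ^ 2)) ?_ ?_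
        · refine fun4 ?_ ?_ ?_ ?_ <;> simp [famP] <;> ring
        · refine fun10 ?_ ?_ ?_ ?_ ?_ ?_ ?_ ?_ ?_ ?_ <;> simp <;> first | ring1 | linear_combination hs
      · left
        obtain ⟨s', hs'⟩ : ∃ s', s' = s + v * (b * u ^ 3) := ⟨_, rfl⟩
        rw [← hs'] at hs
        obtain ⟨m, rfl⟩ : ∃ m, b = m * s' := ⟨b / s', by field_simp⟩
        obtain rfl : s = s' - v * (m * s' * u ^ 3) := by linear_combination -hs'
        simpa using c2_F1 m s' u v (left_ne_zero_of_mul hb) hs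
    · right; right; left
      obtain ⟨b, rfl⟩ := sqr b
      have hb' : b ≠ 0 := by rintro rfl; simp at hb
      obtain ⟨w, rfl⟩ : ∃ w, s = 2 * a ^ 2 * w - v * (b ^ 2 * u ^ 3 - a ^ 2 * u) :=
        ⟨(s + v * (b ^ 2 * u ^ 3 - a ^ 2 * u)) / (2 * a ^ 2), by field_simp; ring⟩
      exact c2_H3 a b u v w ha hb'
  · obtain ⟨a, rfl⟩ := sqr a
    by_cases hg : g = 0
    · subst hg
      exfalso
      refine isfol_x h ?_ ?_ ?_ ?_ ?_ <;> simp
    by_cases ha : a = 0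
    · subst ha
      by_cases hs : s = 0
      · subst hs
        exfalso
        have : ![(0 : ℂ), 0, 2 * 0 ^ 2, 0] = 0 := by
          refine fun4 ?_ ?_ ?_ ?_ <;> simp
        rw [this] at h
        exact isfol_p h
      · left
        obtain ⟨m, rfl⟩ : ∃ m, g = m * s := ⟨g / s, by field_simp⟩
        simpa using c3_F1 m s v w (left_ne_zero_of_mul hg) hs
    · right; right; left
      obtain ⟨g, rfl⟩ := sqr g
      have hg' : g ≠ 0 := by rintro rfl; simp at hg
      obtain ⟨r, rfl⟩ : ∃ r, s = 2 * a ^ 2 * r := ⟨s / (2 * a ^ 2), by field_simp⟩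
      exact c3_H3 a g r v w ha hg'
  · by_cases hb : b = 0
    · subst hb
      by_cases hr : r = 0
      · subst hr
        exfalso
        refine isfol_x h ?_ ?_ ?_ ?_ ?_ <;> simp [famP]
      · by_cases ha : a = 0
        · subst ha
          exfalso
          have : famP 0 0 u = 0 := by
            refine fun4 ?_ ?_ ?_ ?_ <;> simp [famP]
          rw [this] at h
          exact isfol_p h
        · left
          obtain ⟨m, rfl⟩ : ∃ m, a = m * r := ⟨a / r, by field_simp⟩
          exact c4_F1 m r u w (left_ne_zero_of_mul ha) hr
    · by_cases ha : a = 0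
      · subst ha
        exfalso
        refine isfol_Y h u b (2 * b * u) (b * u ^ 2) 0 (3 * b) (3 * b * u) r
          (3 * b * w + 2 * r * u) (3 * b * w * u + r * u ^ 2) ?_ ?_
        · refine fun4 ?_ ?_ ?_ ?_ <;> simp [famP] <;> ring
        · refine fun10 ?_ ?_ ?_ ?_ ?_ ?_ ?_ ?_ ?_ ?_ <;> simp <;> ring
      · right; right; left
        obtain ⟨a, rfl⟩ := sqr a
        obtain ⟨b, rfl⟩ := sqr b
        have ha' : a ≠ 0 := by rintro rfl; simp at ha
        have hb' : b ≠ 0 := by rintro rfl; simp at hb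
        obtain ⟨r', rfl⟩ : ∃ r', r = 2 * b ^ 2 * r' := ⟨r / (2 * b ^ 2), by field_simp⟩
        exact c4_H3 b a u w r' hb' ha'
  · exact (isfol_p h).elim
  · exact (isfol_x h h0 h1 h2 h3 h4).elim

lemma hom_F1 : ∀ i, (OmF1 i).IsHomogeneous 4 := by
  have hX := fun i : Fin 3 => isHomogeneous_X ℂ i
  intro i
  fin_cases i
  · exact ((hX 2).mul ((hX 1).pow 3)).sub (((hX 0).pow 3).mul (hX 1))
  · exact (hX 0).pow 4
  · exact ((hX 0).mul ((hX 1).pow 3)).neg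

lemma hom_F2 : ∀ i, (OmF2 i).IsHomogeneous 4 := by
  have hX := fun i : Fin 3 => isHomogeneous_X ℂ i
  intro i
  fin_cases i
  · exact ((hX 2).mul ((hX 0).pow 3)).sub ((hX 1).pow 4)
  · exact (hX 0).mul ((hX 1).pow 3)
  · exact ((hX 0).pow 4).neg

lemma hom_F3 : ∀ i, (OmF3 i).IsHomogeneous 4 := by
  have hX := fun i : Fin 3 => isHomogeneous_X ℂ i
  intro i
  fin_cases i
  · exact ((hX 1).mul ((hX 2).pow 3)).sub (((hX 1).pow 3).mul (hX 2))
  · exact (((hX 0).pow 3).mul (hX 2)).sub ((hX 0).mul ((hX 2).pow 3))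
  · exact ((hX 0).mul ((hX 1).pow 3)).sub (((hX 0).pow 3).mul (hX 1))

lemma clos_F3 {B : Fin 3 → MvPolynomial (Fin 3) ℂ} (h : B ∈ FClos 3 (OrbitOf OmF3)) : Tgt B := by
  obtain ⟨B', hc, hf, ι, G, T, c, hT, hl⟩ := borel_red hom_F3 h
  have e := fun t => fam_conj (c t) (hT t).1 (hT t).2.1 (hT t).2.2.1 (hT t).2.2.2.1
  obtain ⟨p', q', hp, hq, rfl⟩ := extract (fun i m => (hl i m).congr
    (fun t => by rw [← e t]))
  have := shape_tgt hf (fermat_limits G _ _ _ _ _ _ p' q' hp hq)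
  rcases this with h | h | h | h
  · exact Or.inl (h.trans hc)
  · exact Or.inr (Or.inl (h.trans hc))
  · exact Or.inr (Or.inr (Or.inl (h.trans hc)))
  · exact Or.inr (Or.inr (Or.inr (h.trans hc)))

end

section

open Filter Topology

lemma pow3_lim {ι : Type*} {G : Filter ι} {A u : ι → ℂ} {r : ℂ}
    (hi : Tendsto (fun t => (u t)⁻¹) G (𝓝 0)) (hne : ∀ᶠ t in G, u t ≠ 0)
    (h : Tendsto (fun t => 3 * A t * u t ^ 2) G (𝓝 r)) : Tendsto A G (𝓝 0) := by
  have k1 : Tendsto (fun t => u t * (A t * u t)) G (𝓝 (r / 3)) :=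
    tl (h.div_const 3) (fun t => by ring) rfl
  have k2 := lim_infmul hi hne k1
  exact lim_infmul hi hne (tl k2 (fun t => mul_comm _ _) rfl)

lemma F2_conj {T : Matrix (Fin 3) (Fin 3) ℂ} (c : ℂ) (h01 : T 0 1 = 0) (h02 : T 0 2 = 0)
    (h12 : T 1 2 = 0) (hd : T.det ≠ 0) : ∃ A m s u, (fun i => C c * pb3 T OmF2 i) =
    Om (Pf ![0, 0, 0, m]) (Qf ![0, 0, 0, 0, 0, 0, A, 3 * A * u, 3 * A * u ^ 2, s]) := by
  rw [Matrix.det_fin_three, h01, h02, h12] at hd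
  have h1 : T 1 1 ≠ 0 := by intro h; apply hd; rw [h]; ring
  have hv : ∀ v : Fin 3 → ℂ, v = ![v 0, v 1, v 2] := by
    intro v; funext j; fin_cases j <;> rfl
  obtain ⟨u, hu⟩ : ∃ u, u = T 1 0 / T 1 1 := ⟨_, rfl⟩
  have h10 : T 1 0 = u * T 1 1 := by rw [hu]; field_simp
  refine ⟨c * T 0 0 * T 1 1 ^ 4, c * T 0 0 ^ 4 * T 2 2,
    c * T 0 0 * T 1 1 ^ 4 * u ^ 3 - c * T 0 0 ^ 4 * T 2 1, u, ?_⟩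
  funext i
  apply MvPolynomial.funext
  intro x
  rw [hv x]
  generalize x 0 = x0
  generalize x 1 = x1
  generalize x 2 = x2
  fin_cases i <;>
  · simp [eval_pb3, Fin.sum_univ_three, Om, eval_Pf, eval_Qf, OmF2, Matrix.mulVec,
      dotProduct, h01, h02, h12, h10]
    ring

/-- swapped version of the first form -/
def OmF1s : Fin 3 → MvPolynomial (Fin 3) ℂ :=
  ![X 1 ^ 4, X 0 ^ 3 * X 2 - X 0 * X 1 ^ 3, -(X 0 ^ 3 * X 1)]

lemma F1s_F1 : LinConj3 OmF1s OmF1 := by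
  refine linConj3_of_eval !![0, 1, 0; 1, 0, 0; 0, 0, 1] 1 ?_ (by simp) ?_
  · simp [Matrix.det_fin_three]
  · intro x y z i
    fin_cases i <;>
    · simp [OmF1, OmF1s]
      try ring

lemma hom_F1s : ∀ i, (OmF1s i).IsHomogeneous 4 := by
  have hX := fun i : Fin 3 => isHomogeneous_X ℂ i
  intro i
  fin_cases i
  · exact (hX 1).pow 4
  · exact (((hX 0).pow 3).mul (hX 2)).sub ((hX 0).mul ((hX 1).pow 3))
  · exact (((hX 0).pow 3).mul (hX 1)).neg

lemma F1_conj {T : Matrix (Fin 3) (Fin 3) ℂ} (c : ℂ) (h01 : T 0 1 = 0) (h02 : T 0 2 = 0)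
    (h12 : T 1 2 = 0) (hd : T.det ≠ 0) : ∃ A m s u, (fun i => C c * pb3 T OmF1s i) =
    Om (Pf ![0, 0, m, m * u]) (Qf ![0, 0, 0, m, 0, 0, A, 3 * A * u, 3 * A * u ^ 2, s]) := by
  rw [Matrix.det_fin_three, h01, h02, h12] at hd
  have h1 : T 1 1 ≠ 0 := by intro h; apply hd; rw [h]; ring
  have hv : ∀ v : Fin 3 → ℂ, v = ![v 0, v 1, v 2] := by
    intro v; funext j; fin_cases j <;> rfl
  obtain ⟨u, hu⟩ : ∃ u, u = T 1 0 / T 1 1 := ⟨_, rfl⟩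
  have h10 : T 1 0 = u * T 1 1 := by rw [hu]; field_simp
  refine ⟨-(c * T 0 0 * T 1 1 ^ 4), c * T 0 0 ^ 3 * T 1 1 * T 2 2,
    -(c * T 0 0 * T 1 1 ^ 4) * u ^ 3 + c * T 0 0 ^ 3 * T 1 1 * (T 2 0 - u * T 2 1), u, ?_⟩
  funext i
  apply MvPolynomial.funext
  intro x
  rw [hv x]
  generalize x 0 = x0
  generalize x 1 = x1
  generalize x 2 = x2
  fin_cases i <;>
  · simp [eval_pb3, Fin.sum_univ_three, Om, eval_Pf, eval_Qf, OmF1s, Matrix.mulVec,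
      dotProduct, h01, h02, h12, h10]
    ring

lemma clos_F2 {B : Fin 3 → MvPolynomial (Fin 3) ℂ} (h : B ∈ FClos 3 (OrbitOf OmF2)) :
    LinConj3 OmF2 B := by
  obtain ⟨B', hc, hf, ι, G, T, c, hT, hl⟩ := borel_red hom_F2 h
  have e := fun t => F2_conj (c t) (hT t).1 (hT t).2.1 (hT t).2.2.1 (hT t).2.2.2.1
  choose A m s u e using e
  obtain ⟨p, q, hp, hq, rfl⟩ := extract (fun i m => (hl i m).congr
    (fun t => by rw [← e t]))
  refine LinConj3.trans ?_ hc
  have uq : ∀ {f : ι → ℂ} {a b : ℂ}, Tendsto f G (𝓝 a) → Tendsto f G (𝓝 b) → a = b :=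
    fun h1 h2 => tendsto_nhds_unique h1 h2
  have z : ∀ {a : ℂ}, Tendsto (fun _ : ι => (0 : ℂ)) G (𝓝 a) → a = 0 :=
    fun h1 => tendsto_nhds_unique h1 tendsto_const_nhds
  have p0 := z (hp 0)
  have p1 := z (hp 1)
  have p2 := z (hp 2)
  have q0 := z (hq 0)
  have q1 := z (hq 1)
  have q2 := z (hq 2)
  have q3 := z (hq 3)
  have q4 := z (hq 4)
  have q5 := z (hq 5)
  have q6 := hq 6
  have q7 := hq 7
  have q8 := hq 8
  simp only [Matrix.cons_val] at q6 q7 q8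
  rcases ultra_dich G u with ⟨u', hu⟩ | ⟨hui, hun⟩
  · have h7 : q 7 = 3 * q 6 * u' := uq q7 ((q6.const_mul 3).mul hu)
    have h8 : q 8 = 3 * q 6 * u' ^ 2 := uq q8 ((q6.const_mul 3).mul (hu.pow 2))
    by_cases hA : q 6 = 0
    · exact (isfol_x hf p0 q0 q2 q5 hA).elim
    by_cases hm : p 3 = 0
    · have : p = 0 := fun4 p0 p1 p2 hm
      rw [this] at hf
      exact (isfol_p hf).elim
    refine linConj3_of_eval !![1, 0, 0; u', 1, 0; 0, (q 6 * u' ^ 3 - q 9) / q 6, p 3 / q 6]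
      (q 6)⁻¹ ?_ (by simpa using hA) ?_
    · simp [Matrix.det_fin_three, hA, hm]
    · intro x y z i
      fin_cases i <;>
      · simp [Om, eval_Pf, eval_Qf, OmF2, p0, p1, p2, q0, q1, q2, q3, q4, q5, h7, h8]
        field_simp
        try ring
  · exact (isfol_x hf p0 q0 q2 q5 (uq q6 (pow3_lim hui hun q8))).elim

lemma clos_F1s {B : Fin 3 → MvPolynomial (Fin 3) ℂ} (h : B ∈ FClos 3 (OrbitOf OmF1s)) :
    LinConj3 OmF1s B := by
  obtain ⟨B', hc, hf, ι, G, T, c, hT, hl⟩ := borel_red hom_F1s h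
  have e := fun t => F1_conj (c t) (hT t).1 (hT t).2.1 (hT t).2.2.1 (hT t).2.2.2.1
  choose A m s u e using e
  obtain ⟨p, q, hp, hq, rfl⟩ := extract (fun i m => (hl i m).congr
    (fun t => by rw [← e t]))
  refine LinConj3.trans ?_ hc
  have uq : ∀ {f : ι → ℂ} {a b : ℂ}, Tendsto f G (𝓝 a) → Tendsto f G (𝓝 b) → a = b :=
    fun h1 h2 => tendsto_nhds_unique h1 h2
  have z : ∀ {a : ℂ}, Tendsto (fun _ : ι => (0 : ℂ)) G (𝓝 a) → a = 0 :=
    fun h1 => tendsto_nhds_unique h1 tendsto_const_nhds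
  have p0 := z (hp 0)
  have p1 := z (hp 1)
  have p2 := hp 2
  have p3 := hp 3
  have q0 := z (hq 0)
  have q1 := z (hq 1)
  have q2 := z (hq 2)
  have q3 := hq 3
  have q4 := z (hq 4)
  have q5 := z (hq 5)
  have q6 := hq 6
  have q7 := hq 7
  have q8 := hq 8
  simp only [Matrix.cons_val] at p2 p3 q3 q6 q7 q8
  rcases ultra_dich G u with ⟨u', hu⟩ | ⟨hui, hun⟩
  · have h7 : q 7 = 3 * q 6 * u' := uq q7 ((q6.const_mul 3).mul hu)
    have h8 : q 8 = 3 * q 6 * u' ^ 2 := uq q8 ((q6.const_mul 3).mul (hu.pow 2))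
    have h3 : q 3 = p 2 := uq q3 p2
    have hp3 : p 3 = p 2 * u' := uq p3 (p2.mul hu)
    by_cases hA : q 6 = 0
    · exact (isfol_x hf p0 q0 q2 q5 hA).elim
    by_cases hm : p 2 = 0
    · have : p = 0 := fun4 p0 p1 hm (by rw [hp3, hm]; simp)
      rw [this] at hf
      exact (isfol_p hf).elim
    refine linConj3_of_eval !![1, 0, 0; u', 1, 0; -((q 9 - q 6 * u' ^ 3) / q 6), 0, -(p 2 / q 6)]
      (-(q 6)⁻¹) ?_ (by simpa using hA) ?_
    · simp [Matrix.det_fin_three, hA, hm]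
    · intro x y z i
      fin_cases i <;>
      · simp [Om, eval_Pf, eval_Qf, OmF1s, p0, p1, hp3, q0, q1, q2, h3, q4, q5, h7, h8]
        field_simp
        try ring
  · exact (isfol_x hf p0 q0 q2 q5 (uq q6 (pow3_lim hui hun q8))).elim

lemma orbit_eq {A B : Fin 3 → MvPolynomial (Fin 3) ℂ} (h : LinConj3 A B) :
    OrbitOf A = OrbitOf B := by
  ext D
  exact ⟨fun h1 => h.symm.trans h1, fun h1 => h.trans h1⟩

lemma clos_F1 {B : Fin 3 → MvPolynomial (Fin 3) ℂ} (h : B ∈ FClos 3 (OrbitOf OmF1)) :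
    LinConj3 OmF1 B := by
  rw [← orbit_eq F1s_F1] at h
  exact F1s_F1.symm.trans (clos_F1s h)

end

section

open Filter Topology

lemma relX {h p : MvPolynomial (Fin 3) ℂ} (i : Fin 3) (v : Fin 3 → ℂ) (hv : v i = 0)
    (hp : eval v p ≠ 0) (hd : h ∣ p) : IsRelPrime h (X i) := by
  refine IsRelPrime.symm (IsRelPrime.of_dvd_right ?_ hd)
  refine (X_prime (i := i)).irreducible.isRelPrime_iff_not_dvd.2 ?_
  rintro ⟨q, rfl⟩
  apply hp
  simp [hv]

lemma rel_pow {h p q : MvPolynomial (Fin 3) ℂ} (hr : IsRelPrime h p) (n : ℕ) (hd : h ∣ p ^ n * q) :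
    h ∣ q := by
  induction n with
  | zero => simpa using hd
  | succ n ih =>
    rw [pow_succ', mul_assoc] at hd
    exact ih (hr.dvd_of_dvd_mul_left hd)

lemma deg0 {h p : MvPolynomial (Fin 3) ℂ} (i : Fin 3) (hp : p ≠ 0) (hd : h ∣ p)
    (h0 : degreeOf i p = 0) : degreeOf i h = 0 := by
  obtain ⟨k, rfl⟩ := hd
  rw [degreeOf_mul_eq (left_ne_zero_of_mul hp) (right_ne_zero_of_mul hp)] at h0
  omega

lemma deg0' (i j k : Fin 3) (hj : j ≠ i) (hk : k ≠ i) :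
    degreeOf i (X j ^ 2 - X k ^ 2 : MvPolynomial (Fin 3) ℂ) = 0 := by
  have a := degreeOf_sub_le i (X j ^ 2 : MvPolynomial (Fin 3) ℂ) (X k ^ 2)
  have b := degreeOf_pow_le i (X j : MvPolynomial (Fin 3) ℂ) 2
  have c := degreeOf_pow_le i (X k : MvPolynomial (Fin 3) ℂ) 2
  rw [degreeOf_X_of_ne hj.symm] at b
  rw [degreeOf_X_of_ne hk.symm] at c
  simp at b c
  simp [b, c] at a
  exact a

lemma ne0' (j k : Fin 3) (hj : j ≠ k) : (X j ^ 2 - X k ^ 2 : MvPolynomial (Fin 3) ℂ) ≠ 0 := by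
  intro h
  have := congrArg (eval (Pi.single j (1 : ℂ))) h
  simp [hj.symm] at this

lemma hom_H1 : ∀ i, (OmH1 i).IsHomogeneous 4 := by
  have hX := fun i : Fin 3 => isHomogeneous_X ℂ i
  intro i
  fin_cases i
  · exact (hX 2).mul ((hX 1).pow 3)
  · exact ((hX 2).mul ((hX 0).pow 3)).neg
  · exact (((hX 0).pow 3).mul (hX 1)).sub ((hX 0).mul ((hX 1).pow 3))

lemma hom_H3 : ∀ i, (OmH3 i).IsHomogeneous 4 := by
  have hX := fun i : Fin 3 => isHomogeneous_X ℂ i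
  have h3 : (3 : MvPolynomial (Fin 3) ℂ).IsHomogeneous 0 := by
    have := isHomogeneous_C (Fin 3) (3 : ℂ)
    rwa [map_ofNat C 3] at this
  intro i
  fin_cases i
  · exact (hX 2).mul (((h3.mul (hX 0)).mul ((hX 1).pow 2)).add ((hX 1).pow 3))
  · exact ((hX 2).mul (((hX 0).pow 3).add ((h3.mul ((hX 0).pow 2)).mul (hX 1)))).neg
  · exact (((hX 0).pow 3).mul (hX 1)).sub ((hX 0).mul ((hX 1).pow 3))

lemma ne_of_eval {A : Fin 3 → MvPolynomial (Fin 3) ℂ} (i : Fin 3) (v : Fin 3 → ℂ)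
    (h : eval v (A i) ≠ 0) : A ≠ 0 := by
  rintro rfl; simp at h

lemma fol_F1 : IsFolDeg 3 OmF1 := by
  refine ⟨ne_of_eval 1 ![1, 0, 0] (by simp [OmF1]), hom_F1, by simp [OmF1]; ring, ?_⟩
  intro h hd
  have r0 := relX 0 ![0, 1, 1] (by simp) (by simp [OmF1]) (hd 0)
  have h1 : h ∣ X 0 ^ 4 * 1 := by simpa [OmF1] using hd 1
  exact isUnit_of_dvd_one (rel_pow r0 4 h1)

lemma fol_F2 : IsFolDeg 3 OmF2 := by
  refine ⟨ne_of_eval 2 ![1, 0, 0] (by simp [OmF2]), hom_F2, by simp [OmF2]; ring, ?_⟩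
  intro h hd
  have r0 := relX 0 ![0, 1, 1] (by simp) (by simp [OmF2]) (hd 0)
  have h1 : h ∣ X 0 ^ 4 * 1 := by simpa [OmF2] using hd 2
  exact isUnit_of_dvd_one (rel_pow r0 4 h1)

lemma fol_H1 : IsFolDeg 3 OmH1 := by
  refine ⟨ne_of_eval 0 ![0, 1, 1] (by simp [OmH1]), hom_H1, by simp [OmH1]; ring, ?_⟩
  intro h hd
  have r2 := relX 2 ![1, 2, 0] (by simp) (by simp [OmH1]; norm_num) (hd 2)
  have r0 := relX 0 ![0, 1, 1] (by simp) (by simp [OmH1]) (hd 0)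
  have h1 : h ∣ X 2 * (X 0 ^ 3 * 1) := by simpa [OmH1] using hd 1
  exact isUnit_of_dvd_one (rel_pow r0 3 (r2.dvd_of_dvd_mul_left h1))

lemma fol_H3 : IsFolDeg 3 OmH3 := by
  refine ⟨ne_of_eval 0 ![0, 1, 1] (by simp [OmH3]), hom_H3, by simp [OmH3]; ring, ?_⟩
  intro h hd
  have r2 := relX 2 ![1, 2, 0] (by simp) (by simp [OmH3]; norm_num) (hd 2)
  have r0 := relX 0 ![0, 1, 1] (by simp) (by simp [OmH3]) (hd 0)
  have r1 := relX 1 ![1, 0, 1] (by simp) (by simp [OmH3]) (hd 1)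
  have h0 : h ∣ X 2 * (X 1 ^ 2 * (3 * X 0 + X 1)) := by
    have := hd 0
    simp only [OmH3, Matrix.cons_val] at this
    convert this using 1; ring
  have h1 : h ∣ X 2 * (X 0 ^ 2 * (X 0 + 3 * X 1)) := by
    have := (hd 1).neg_right
    simp only [OmH3, Matrix.cons_val] at this
    convert this using 1; ring
  have k0 := rel_pow r1 2 (r2.dvd_of_dvd_mul_left h0)
  have k1 := rel_pow r0 2 (r2.dvd_of_dvd_mul_left h1)
  have k2 : h ∣ X 0 * C (8 : ℂ) := by
    have := dvd_sub (k0.mul_left 3) k1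
    convert this using 1
    have : (C (8 : ℂ) : MvPolynomial (Fin 3) ℂ) = 8 := map_ofNat C 8
    rw [this]; ring
  exact isUnit_of_dvd_unit (r0.dvd_of_dvd_mul_left k2) ((isUnit_iff_ne_zero.2 (by norm_num)).map C)

lemma fol_F3 : IsFolDeg 3 OmF3 := by
  refine ⟨ne_of_eval 0 ![0, 1, 2] (by simp [OmF3]; norm_num), hom_F3, by simp [OmF3]; ring, ?_⟩
  intro h hd
  have r0 := relX 0 ![0, 1, 2] (by simp) (by simp [OmF3]; norm_num) (hd 0)
  have r1 := relX 1 ![1, 0, 2] (by simp) (by simp [OmF3]; norm_num) (hd 1)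
  have r2 := relX 2 ![1, 2, 0] (by simp) (by simp [OmF3]; norm_num) (hd 2)
  have h0 : h ∣ X 1 * (X 2 * (X 2 ^ 2 - X 1 ^ 2)) := by
    have := hd 0
    simp only [OmF3, Matrix.cons_val] at this
    convert this using 1; ring
  have h1 : h ∣ X 0 * (X 2 * (X 0 ^ 2 - X 2 ^ 2)) := by
    have := hd 1
    simp only [OmF3, Matrix.cons_val] at this
    convert this using 1; ring
  have h2 : h ∣ X 0 * (X 1 * (X 1 ^ 2 - X 0 ^ 2)) := by
    have := hd 2
    simp only [OmF3, Matrix.cons_val] at this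
    convert this using 1; ring
  have k0 := r2.dvd_of_dvd_mul_left (r1.dvd_of_dvd_mul_left h0)
  have k1 := r2.dvd_of_dvd_mul_left (r0.dvd_of_dvd_mul_left h1)
  have k2 := r1.dvd_of_dvd_mul_left (r0.dvd_of_dvd_mul_left h2)
  have d0 := deg0 0 (ne0' 2 1 (by decide)) k0 (deg0' 0 2 1 (by decide) (by decide))
  have d1 := deg0 1 (ne0' 0 2 (by decide)) k1 (deg0' 1 0 2 (by decide) (by decide))
  have d2 := deg0 2 (ne0' 1 0 (by decide)) k2 (deg0' 2 1 0 (by decide) (by decide))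
  have hC : h = C (h.coeff 0) := by
    rw [← vars_eq_empty_iff_eq_C, Finset.eq_empty_iff_forall_notMem]
    intro i hi
    have : degreeOf i h ≠ 0 := by
      rw [degreeOf_eq_sup]
      intro h0
      rw [mem_vars_iff_mem_support] at hi
      obtain ⟨m, hm, hi⟩ := hi
      have := Finset.le_sup (f := fun m : Fin 3 →₀ ℕ => m i) hm
      rw [h0] at this
      simp at hi
      simp at this
      exact hi this
    fin_cases i
    · exact this d0
    · exact this d1
    · exact this d2
  have hne : h ≠ 0 := by
    rintro rfl
    exact ne0' 2 1 (by decide) (zero_dvd_iff.1 k0)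
  rw [hC]
  refine (isUnit_iff_ne_zero.2 ?_).map C
  intro h0
  rw [h0, C_0] at hC
  exact hne hC

lemma Om_fam_hom {B : Fin 3 → MvPolynomial (Fin 3) ℂ} (h : LinConj3 OmF3 B) :
    ∀ i, (B i).IsHomogeneous 4 := (isFol_of_conj h fol_F3).2.1

lemma curve {p : ℕ → Fin 4 → ℂ} {q : ℕ → Fin 10 → ℂ} {p' : Fin 4 → ℂ} {q' : Fin 10 → ℂ}
    {A B : Fin 3 → MvPolynomial (Fin 3) ℂ} (hA : IsFolDeg 3 A)
    (h1 : ∀ n, LinConj3 OmF3 (Om (Pf (p n)) (Qf (q n))))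
    (hp : ∀ k, Tendsto (fun t => p t k) atTop (𝓝 (p' k)))
    (hq : ∀ k, Tendsto (fun t => q t k) atTop (𝓝 (q' k)))
    (h2 : LinConj3 A (Om (Pf p') (Qf q'))) (hB : LinConj3 A B) :
    B ∈ FClos 3 (OrbitOf OmF3) := by
  refine ⟨isFol_of_conj hB hA, ?_⟩
  have h3 := isFol_of_conj h2 hA
  obtain ⟨M, c, hM, hc, e⟩ := h2.symm.trans hB
  have e' : B = fun i => C c⁻¹ * pb3 M (Om (Pf p') (Qf q')) i := by
    rw [e]; funext i
    rw [← mul_assoc, ← C_mul, inv_mul_cancel₀ hc, C_1, one_mul]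
  have key : Tendsto (fun n => coeffs (fun i => C c⁻¹ * pb3 M (Om (Pf (p n)) (Qf (q n))) i)) atTop
      (𝓝 (coeffs B)) := by
    rw [tendsto_coeffs_iff, e']
    intro i m
    refine tendsto_coeff_mul (tendsto_coeff_C tendsto_const_nhds) ?_ m
    exact tendsto_coeffs_pb (U := fun _ => M) (fun _ _ => tendsto_const_nhds)
      (fun n => Om_fam_hom (h1 n)) h3.2.1 (tendsto_Om hp hq) i
  refine mem_closure_of_tendsto key (Eventually.of_forall fun n => ⟨_, ?_, rfl⟩)
  refine (h1 n).trans ⟨M, c, hM, hc, ?_⟩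
  funext i
  rw [← mul_assoc, ← C_mul, mul_inv_cancel₀ hc, C_1, one_mul]

/-- the sequence tending to zero -/
def tn (n : ℕ) : ℂ := 1 / ((n : ℂ) + 1)

lemma tn_ne (n : ℕ) : tn n ≠ 0 := by
  unfold tn
  have : ((n : ℂ) + 1) ≠ 0 := by exact_mod_cast Nat.succ_ne_zero n
  simp [this]

lemma tn_lim : Tendsto tn atTop (𝓝 0) := tendsto_one_div_add_atTop_nhds_zero_nat

lemma tn_one (n : ℕ) : tn n + 1 ≠ 0 := by
  unfold tn
  have : ((n : ℂ) + 1) ≠ 0 := by exact_mod_cast Nat.succ_ne_zero n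
  have h2 : ((n : ℂ) + 2) ≠ 0 := by exact_mod_cast Nat.succ_ne_zero (n + 1)
  intro h
  apply h2
  field_simp at h
  linear_combination h

lemma tpoly {f : ℂ → ℂ} {g : ℕ → ℂ} {l : ℂ} (hf : Continuous f) (h0 : f 0 = l)
    (h : ∀ n, g n = f (tn n)) : Tendsto g atTop (𝓝 l) := by
  have := (hf.tendsto 0).comp tn_lim
  rw [h0] at this
  exact this.congr (fun n => (h n).symm)

lemma c1' (a b c u v w : ℂ) (ha : a ≠ 0) (hb : b ≠ 0) (hc : c ≠ 0) :
    LinConj3 OmF3 (Om (Pf (famP a b u)) (Qf (famQ a b c u v w))) := by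
  obtain ⟨a, rfl⟩ := sqr a
  obtain ⟨b, rfl⟩ := sqr b
  obtain ⟨c, rfl⟩ := sqr c
  exact c1_all a b c u v w (by rintro rfl; simp at ha) (by rintro rfl; simp at hb)
    (by rintro rfl; simp at hc)

lemma in_H1 {B : Fin 3 → MvPolynomial (Fin 3) ℂ} (hB : LinConj3 OmH1 B) :
    B ∈ FClos 3 (OrbitOf OmF3) := by
  have h2 := c1_g 1 1 0 0 0 one_ne_zero one_ne_zero
  refine curve fol_H1 (fun n => c1' 1 1 (tn n) 0 0 0 one_ne_zero one_ne_zero (tn_ne n)) ?_ ?_ h2 hB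
  · intro k; simp
  · intro k
    fin_cases k
    · exact tn_lim
    all_goals simp [famQ]

lemma in_H3 {B : Fin 3 → MvPolynomial (Fin 3) ℂ} (hB : LinConj3 OmH3 B) :
    B ∈ FClos 3 (OrbitOf OmF3) := by
  have h2 := c2_H3 1 1 0 0 0 one_ne_zero one_ne_zero
  refine curve fol_H3 (fun n => c1' 1 1 (tn n ^ 2) 0 0 (1 / tn n) one_ne_zero one_ne_zero
    (pow_ne_zero 2 (tn_ne n))) ?_ ?_ h2 hB
  · intro k; simp
  · intro k
    fin_cases k
    · exact tpoly (f := fun t => t ^ 2) (by fun_prop) (by simp)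
        (fun n => by simp [famQ])
    · exact tpoly (f := fun t => 3 * t) (by fun_prop) (by simp)
        (fun n => by have := tn_ne n; simp [famQ]; field_simp)
    · simp [famQ]
    · exact tpoly (f := fun t => 2) (by fun_prop) (by simp)
        (fun n => by have := tn_ne n; simp [famQ]; field_simp; ring)
    · simp [famQ]
    · simp [famQ]
    · simp [famQ]
    · simp [famQ]
    · simp [famQ]
    · exact tpoly (f := fun t => 0) (by fun_prop) (by simp)
        (fun n => by have := tn_ne n; simp [famQ]; field_simp; ring)

lemma in_F1 {B : Fin 3 → MvPolynomial (Fin 3) ℂ} (hB : LinConj3 OmF1 B) :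
    B ∈ FClos 3 (OrbitOf OmF3) := by
  have h2 := c2_F1 1 1 0 0 one_ne_zero one_ne_zero
  refine curve fol_F1 (fun n => c1' (tn n ^ 2) 1 (tn n ^ 3 * (tn n + 1)) 0 0 (1 / tn n)
    (pow_ne_zero 2 (tn_ne n)) one_ne_zero
    (mul_ne_zero (pow_ne_zero 3 (tn_ne n)) (tn_one n))) ?_ ?_ h2 hB
  · intro k
    fin_cases k
    · simp [famP]
    · simp [famP]
    · exact tpoly (f := fun t => - t ^ 2) (by fun_prop) (by simp [famP])
        (fun n => by simp [famP])
    · simp [famP]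
  · intro k
    fin_cases k
    · exact tpoly (f := fun t => t ^ 3 * (t + 1)) (by fun_prop) (by simp)
        (fun n => by simp [famQ])
    · exact tpoly (f := fun t => 3 * t ^ 2 * (t + 1)) (by fun_prop) (by simp)
        (fun n => by have := tn_ne n; simp [famQ]; field_simp)
    · simp [famQ]
    · exact tpoly (f := fun t => 3 * t * (t + 1) - t ^ 2) (by fun_prop) (by simp)
        (fun n => by have := tn_ne n; simp [famQ]; field_simp)
    · simp [famQ]
    · simp [famQ]
    · simp [famQ]
    · simp [famQ]
    · simp [famQ]
    · exact tpoly (f := fun t => 1) (by fun_prop) (by simp)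
        (fun n => by have := tn_ne n; simp [famQ]; field_simp; ring)

lemma self_clos {A B : Fin 3 → MvPolynomial (Fin 3) ℂ} (hA : IsFolDeg 3 A) (h : LinConj3 A B) :
    B ∈ FClos 3 (OrbitOf A) :=
  ⟨isFol_of_conj h hA, subset_closure ⟨B, h, rfl⟩⟩

lemma main_result :
    FClos 3 (OrbitOf OmF1) = OrbitOf OmF1 ∧
    FClos 3 (OrbitOf OmF2) = OrbitOf OmF2 ∧
    FClos 3 (OrbitOf OmF3) =
      OrbitOf OmF1 ∪ OrbitOf OmH1 ∪ OrbitOf OmH3 ∪ OrbitOf OmF3 := by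
  refine ⟨?_, ?_, ?_⟩
  · ext B
    exact ⟨clos_F1, self_clos fol_F1⟩
  · ext B
    exact ⟨clos_F2, self_clos fol_F2⟩
  · ext B
    constructor
    · intro h
      rcases clos_F3 h with h | h | h | h
      · exact Or.inl (Or.inl (Or.inl h))
      · exact Or.inl (Or.inl (Or.inr h))
      · exact Or.inl (Or.inr h)
      · exact Or.inr h
    · rintro (((h | h) | h) | h)
      · exact in_F1 h
      · exact in_H1 h
      · exact in_H3 h
      · exact self_clos fol_F3 h

end

/-- **Closed orbits and the orbit closure of the Fermat foliation.**
In `F(3)` with the `PGL₃(ℂ)`-action: (1) the orbits of `F₁` and `F₂` are closed;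
(2) the closure of the orbit of the Fermat foliation `F₃` is
`O(F₁) ∪ O(H₁) ∪ O(H₃) ∪ O(F₃)`. -/
theorem stmt_12 :
    FClos 3 (OrbitOf OmF1) = OrbitOf OmF1 ∧
    FClos 3 (OrbitOf OmF2) = OrbitOf OmF2 ∧
    FClos 3 (OrbitOf OmF3) =
      OrbitOf OmF1 ∪ OrbitOf OmH1 ∪ OrbitOf OmH3 ∪ OrbitOf OmF3 := by
  exact main_result
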